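/- arXiv:1612.03663 — 13 statements merged into one kernel-verified Lean document; each statement's English description precedes it below -/
import Mathlib

section
/- Fix integers m ≥ 2 and 1 ≤ k < m. For a score vector g ∈ ℝ^m with pairwise distinct components and a label y, the top-k error is err_k(y,g) = 1 if |{j : g_j > g_y}| ≥ k and 0 otherwise. Then for every probability vector p ∈ ℝ^m, the minimum over all g ∈ ℝ^m with pairwise distinct components of the expected top-k error Σ_{y=1}^m err_k(y,g)·p_y equals 1 − (the sum of the k largest components of p). Moreover, such a g attains this minimum if and only if the set T_k(g) of the k labels with the largest scores under g satisfies Σ_{y ∈ T_k(g)} p_y = max over all k-element subsets S of {1,…,m} of Σ_{y ∈ S} p_y. -/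
open Finset

/-- The top-k zero-one error: 1 if at least `k` other scores exceed the score of
the ground-truth label `y`, and 0 otherwise. -/
noncomputable def topkErr {m : ℕ} (k : ℕ) (g : Fin m → ℝ) (y : Fin m) : ℝ :=
  if k ≤ (univ.filter (fun j => g y < g j)).card then 1 else 0

/-- The set of the `k` labels with the largest scores under `g`
(well-defined as a `k`-element set when `g` has pairwise distinct components). -/
noncomputable def topkSet {m : ℕ} (k : ℕ) (g : Fin m → ℝ) : Finset (Fin m) :=
  univ.filter (fun y => (univ.filter (fun j => g y < g j)).card < k)

lemma rank_strict {m : ℕ} (g : Fin m → ℝ) {y z : Fin m} (h : g y < g z) :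
    (univ.filter (fun j => g z < g j)).card < (univ.filter (fun j => g y < g j)).card := by
  apply Finset.card_lt_card
  rw [Finset.ssubset_iff_of_subset]
  · exact ⟨z, by simpa using h, by simp⟩
  · intro j hj
    simp only [mem_filter, mem_univ, true_and] at hj ⊢
    exact h.trans hj

lemma rank_lt {m : ℕ} (g : Fin m → ℝ) (y : Fin m) :
    (univ.filter (fun j => g y < g j)).card < m := by
  have h : (univ.filter (fun j => g y < g j)).card < (univ : Finset (Fin m)).card := by
    apply Finset.card_lt_card
    rw [Finset.ssubset_iff_of_subset (Finset.subset_univ _)]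
    exact ⟨y, by simp, by simp⟩
  simpa using h

lemma card_topkSet {m k : ℕ} (hkm : k < m) (g : Fin m → ℝ) (hg : Function.Injective g) :
    (topkSet k g).card = k := by
  let r : Fin m → Fin m := fun y => ⟨_, rank_lt g y⟩
  have hr : Function.Injective r := by
    intro y z h
    have h' : (univ.filter (fun j => g y < g j)).card
        = (univ.filter (fun j => g z < g j)).card := congrArg Fin.val h
    rcases lt_trichotomy (g y) (g z) with h1 | h1 | h1
    · have := rank_strict g h1
      omega
    · exact hg h1
    · have := rank_strict g h1
      omega
  have hs : Function.Surjective r := Finite.surjective_of_injective hr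
  have himg : (topkSet k g).image r = Finset.Iio (⟨k, hkm⟩ : Fin m) := by
    ext i
    simp only [mem_image, mem_Iio, topkSet, mem_filter, mem_univ, true_and]
    constructor
    · rintro ⟨y, hy, rfl⟩
      exact hy
    · intro hi
      obtain ⟨y, rfl⟩ := hs i
      exact ⟨y, hi, rfl⟩
  rw [← Finset.card_image_of_injective _ hr, himg]
  simp

lemma sum_err {m k : ℕ} (g p : Fin m → ℝ) (hp1 : ∑ y, p y = 1) :
    ∑ y, topkErr k g y * p y = 1 - ∑ y ∈ topkSet k g, p y := by
  rw [← hp1, topkSet, Finset.sum_filter, ← Finset.sum_sub_distrib]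
  apply Finset.sum_congr rfl
  intro y _
  unfold topkErr
  split_ifs with h1 h2 h2
  · omega
  · simp
  · simp
  · omega

lemma exists_score {m k : ℕ} (hkm : k < m) (S : Finset (Fin m)) (hS : S.card = k) :
    ∃ g : Fin m → ℝ, Function.Injective g ∧ topkSet k g = S := by
  let f : Fin m → ℕ := fun y => (if y ∈ S then m else 0) + y
  have hf : Function.Injective f := by
    intro y z h
    have h1 := y.2
    have h2 := z.2
    simp only [f] at h
    apply Fin.ext
    split_ifs at h <;> omega
  have hg : Function.Injective (fun y => (f y : ℝ)) := fun y z h => hf (Nat.cast_injective h)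
  refine ⟨_, hg, ?_⟩
  symm
  apply Finset.eq_of_subset_of_card_le
  · intro y hy
    simp only [topkSet, mem_filter, mem_univ, true_and, Nat.cast_lt]
    rw [← hS]
    apply Finset.card_lt_card
    rw [Finset.ssubset_iff_of_subset]
    · exact ⟨y, hy, by simp⟩
    · intro j hj
      simp only [mem_filter, mem_univ, true_and, f, if_pos hy] at hj
      by_contra hn
      rw [if_neg hn] at hj
      have := j.2
      omega
  · rw [card_topkSet hkm _ hg, hS]

theorem stmt_0 (m k : ℕ) (hm : 2 ≤ m) (hk1 : 1 ≤ k) (hkm : k < m)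
    (p : Fin m → ℝ) (hp0 : ∀ y, 0 ≤ p y) (hp1 : ∑ y, p y = 1)
    (M : ℝ)
    (hM1 : ∀ S : Finset (Fin m), S.card = k → ∑ y ∈ S, p y ≤ M)
    (hM2 : ∃ S : Finset (Fin m), S.card = k ∧ ∑ y ∈ S, p y = M) :
    IsLeast {r : ℝ | ∃ g : Fin m → ℝ, Function.Injective g ∧
        r = ∑ y, topkErr k g y * p y} (1 - M) ∧
    ∀ g : Fin m → ℝ, Function.Injective g →
      ((∑ y, topkErr k g y * p y) = 1 - M ↔ ∑ y ∈ topkSet k g, p y = M) := by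
  refine ⟨⟨?_, ?_⟩, ?_⟩
  · obtain ⟨S, hS, hSM⟩ := hM2
    obtain ⟨g, hg, hgS⟩ := exists_score hkm S hS
    exact ⟨g, hg, by rw [sum_err g p hp1, hgS, hSM]⟩
  · rintro r ⟨g, hg, rfl⟩
    rw [sum_err g p hp1]
    have := hM1 _ (card_topkSet hkm g hg)
    linarith
  · intro g _
    rw [sum_err g p hp1]
    constructor <;> intro h <;> linarith
end

section
/- Fix integers m ≥ 2 and 1 ≤ k < m, and let φ : (0,1) → ℝ be strictly monotonically increasing. Let p ∈ ℝ^m be a probability vector with pairwise distinct components all lying in (0,1), and define g ∈ ℝ^m by g_y = φ(p_y). Then g has pairwise distinct components, and for every k with 1 ≤ k < m, g minimizes the expected top-k error Σ_{y=1}^m err_k(y,g)·p_y over all vectors in ℝ^m with pairwise distinct components; i.e., the one-vs-all reduction built from a loss whose Bayes optimal score is a strictly increasing function of the class probability is top-k calibrated for all k. -/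
open Finset

noncomputable def rk {m : ℕ} (g : Fin m → ℝ) (y : Fin m) : ℕ :=
  (univ.filter (fun j => g y < g j)).card

theorem rk_lt {m : ℕ} (g : Fin m → ℝ) {a b : Fin m} (h : g a < g b) : rk g b < rk g a := by
  apply Finset.card_lt_card
  rw [Finset.ssubset_iff_of_subset]
  · exact ⟨b, by simpa using h, by simp⟩
  · intro j hj
    simp only [mem_filter, mem_univ, true_and] at hj ⊢
    exact h.trans hj

theorem rk_bound {m : ℕ} (g : Fin m → ℝ) (y : Fin m) : rk g y < m := by
  have h : (univ.filter (fun j => g y < g j)).card < (univ : Finset (Fin m)).card := by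
    apply Finset.card_lt_card
    rw [Finset.ssubset_iff_of_subset (Finset.subset_univ _)]
    exact ⟨y, by simp, by simp⟩
  simpa [rk] using h

theorem rk_bij {m : ℕ} (g : Fin m → ℝ) (hg : Function.Injective g) :
    Function.Bijective (fun y => (⟨rk g y, rk_bound g y⟩ : Fin m)) := by
  rw [← Finite.injective_iff_bijective]
  intro a b hab
  have hab' : rk g a = rk g b := by simpa using hab
  rcases lt_trichotomy (g a) (g b) with h | h | h
  · have := rk_lt g h
    omega
  · exact hg h
  · have := rk_lt g h
    omega

theorem sum_err_s1 {m : ℕ} (k : ℕ) (g : Fin m → ℝ) (hg : Function.Injective g) :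
    ∑ y, topkErr k g y = ∑ i : Fin m, if k ≤ (i : ℕ) then (1 : ℝ) else 0 :=
  Function.Bijective.sum_comp (rk_bij g hg) (fun i : Fin m => if k ≤ (i : ℕ) then (1 : ℝ) else 0)

theorem stmt_1 (m : ℕ) (hm : 2 ≤ m)
    (φ : ℝ → ℝ) (hφ : StrictMonoOn φ (Set.Ioo 0 1))
    (p : Fin m → ℝ) (hp0 : ∀ y, 0 ≤ p y) (hp1 : ∑ y, p y = 1)
    (hpdist : Function.Injective p) (hpin : ∀ y, p y ∈ Set.Ioo (0:ℝ) 1) :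
    Function.Injective (fun y => φ (p y)) ∧
    ∀ k : ℕ, 1 ≤ k → k < m →
      ∀ g' : Fin m → ℝ, Function.Injective g' →
        ∑ y, topkErr k (fun y => φ (p y)) y * p y ≤ ∑ y, topkErr k g' y * p y := by
  have hinj : Function.Injective (fun y => φ (p y)) := fun a b hab =>
    hpdist (hφ.injOn (hpin a) (hpin b) hab)
  refine ⟨hinj, fun k _ hkm g' hg' => ?_⟩
  set g : Fin m → ℝ := fun y => φ (p y) with hgdef
  obtain ⟨y0, hy0⟩ := (rk_bij g hinj).2 ⟨k, hkm⟩
  have hy0' : rk g y0 = k := by simpa using hy0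
  have key : ∀ y, (topkErr k g y - topkErr k g' y) * (p y - p y0) ≤ 0 := by
    intro y
    have h01 : 0 ≤ topkErr k g' y ∧ topkErr k g' y ≤ 1 := by
      unfold topkErr
      split_ifs <;> norm_num
    by_cases h : k ≤ rk g y
    · have he : topkErr k g y = 1 := if_pos h
      have hp : p y ≤ p y0 := by
        by_contra! hc
        have := rk_lt g (hφ (hpin y0) (hpin y) hc)
        omega
      rw [he]
      exact mul_nonpos_of_nonneg_of_nonpos (by linarith) (by linarith)
    · have he : topkErr k g y = 0 := if_neg h
      have hp : p y0 ≤ p y := by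
        by_contra! hc
        have := rk_lt g (hφ (hpin y) (hpin y0) hc)
        omega
      rw [he]
      exact mul_nonpos_of_nonpos_of_nonneg (by linarith) (by linarith)
  have hs : ∑ y, (topkErr k g y - topkErr k g' y) * (p y - p y0) ≤ 0 :=
    Finset.sum_nonpos fun y _ => key y
  have heq : ∑ y, (topkErr k g y - topkErr k g' y) * (p y - p y0)
      = (∑ y, topkErr k g y * p y - ∑ y, topkErr k g' y * p y)
        - (∑ y, topkErr k g y - ∑ y, topkErr k g' y) * p y0 := by
    rw [← Finset.sum_sub_distrib, ← Finset.sum_sub_distrib, Finset.sum_mul,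
      ← Finset.sum_sub_distrib]
    exact Finset.sum_congr rfl fun y _ => by ring
  rw [heq, sum_err_s1 k g hinj, sum_err_s1 k g' hg'] at hs
  linarith
end

section
/- For the binary logistic loss L(α) = log(1 + exp(−α)) and any p ∈ (0,1), the function R_p(α) = log(1 + e^{−α})·p + log(1 + e^{α})·(1 − p) over α ∈ ℝ has the unique minimizer α* = log(p / (1 − p)). Moreover, the map p ↦ log(p/(1−p)) is strictly monotonically increasing on (0,1); consequently the one-vs-all logistic regression scheme is top-k calibrated for all 1 ≤ k ≤ m. -/
open Finset

/-- Pointwise risk of the binary logistic loss with class-1 probability `p`. -/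
noncomputable def logRisk (p α : ℝ) : ℝ :=
  Real.log (1 + Real.exp (-α)) * p + Real.log (1 + Real.exp α) * (1 - p)

theorem aux_strict (p : ℝ) (hp : p ∈ Set.Ioo (0:ℝ) 1) (α : ℝ) (hα : α ≠ Real.log (p / (1 - p))) :
    logRisk p (Real.log (p / (1 - p))) < logRisk p α := by
  obtain ⟨h0, h1⟩ := hp
  have h1' : 0 < 1 - p := by linarith
  have hx : 0 < Real.exp α := Real.exp_pos α
  unfold logRisk
  rw [Real.exp_neg, Real.exp_neg, Real.exp_log (div_pos h0 h1')]
  have hne : Real.exp α ≠ p / (1 - p) := by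
    intro h
    apply hα
    rw [← h, Real.log_exp]
  set x := Real.exp α with hxd
  have e1 : 1 + (p / (1 - p))⁻¹ = 1 / p := by field_simp; ring
  have e2 : 1 + p / (1 - p) = 1 / (1 - p) := by field_simp; ring
  rw [e1, e2]
  have hA : 0 < 1 + x⁻¹ := by positivity
  have hB : 0 < 1 + x := by positivity
  have hne2 : 1 / p / (1 + x⁻¹) ≠ 1 := by
    intro h
    apply hne
    field_simp at h ⊢
    linarith
  have l1 := Real.log_lt_sub_one_of_pos (x := 1 / p / (1 + x⁻¹)) (by positivity) hne2
  have l2 := Real.log_le_sub_one_of_pos (x := 1 / (1 - p) / (1 + x)) (by positivity)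
  rw [Real.log_div (by positivity) hA.ne'] at l1
  rw [Real.log_div (by positivity) hB.ne'] at l2
  have m1 := mul_lt_mul_of_pos_right l1 h0
  have m2 := mul_le_mul_of_nonneg_right l2 h1'.le
  have e3 : (1 / p / (1 + x⁻¹) - 1) * p + (1 / (1 - p) / (1 + x) - 1) * (1 - p) = 0 := by
    field_simp
    ring
  nlinarith

theorem aux_mono : StrictMonoOn (fun p : ℝ => Real.log (p / (1 - p))) (Set.Ioo 0 1) := by
  intro a ha b hb hab
  have ha1 : 0 < 1 - a := by linarith [ha.2]
  have hb1 : 0 < 1 - b := by linarith [hb.2]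
  apply Real.log_lt_log (div_pos ha.1 ha1)
  rw [div_lt_div_iff₀ ha1 hb1]
  nlinarith

theorem aux_sum {m : ℕ} (k : ℕ) (g : Fin m → ℝ) :
    ∑ y, topkErr k g y
      = ((univ.filter (fun y => k ≤ (univ.filter (fun j => g y < g j)).card)).card : ℝ) := by
  simp [topkErr]

theorem aux_upper {m : ℕ} (k : ℕ) (hk : 1 ≤ k) (g : Fin m → ℝ) (hg : Function.Injective g) :
    (univ.filter (fun y => ¬ k ≤ (univ.filter (fun j => g y < g j)).card)).card ≤ k := by
  set A := univ.filter (fun y => ¬ k ≤ (univ.filter (fun j => g y < g j)).card) with hA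
  rcases A.eq_empty_or_nonempty with h | h
  · simp [h]
  · obtain ⟨y, hy, hmin⟩ := A.exists_min_image g h
    have hsub : A.erase y ⊆ univ.filter (fun j => g y < g j) := by
      intro j hj
      rw [mem_erase] at hj
      simp only [mem_filter, mem_univ, true_and]
      exact lt_of_le_of_ne (hmin j hj.2) (fun e => hj.1 (hg e).symm)
    have h1 := card_le_card hsub
    rw [card_erase_of_mem hy] at h1
    have h2 := (mem_filter.1 hy).2
    omega

theorem aux_topk {m : ℕ} (k : ℕ) (hk : 1 ≤ k) (p : Fin m → ℝ) (hp : ∀ y, 0 ≤ p y)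
    (g : Fin m → ℝ) (hg : Function.Injective g) :
    ∑ y, topkErr k p y * p y ≤ ∑ y, topkErr k g y * p y := by
  have herr : ∀ y, 0 ≤ topkErr k g y ∧ topkErr k g y ≤ 1 := by
    intro y; unfold topkErr; split_ifs <;> norm_num
  set B := univ.filter (fun y => k ≤ (univ.filter (fun j => p y < p j)).card) with hB
  rcases B.eq_empty_or_nonempty with h | h
  · apply sum_le_sum
    intro y _
    have : topkErr k p y = 0 := by
      unfold topkErr
      rw [if_neg]
      intro hy
      have : y ∈ B := by simp [hB, hy]
      simp [h] at this
    rw [this, zero_mul]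
    exact mul_nonneg (herr y).1 (hp y)
  · obtain ⟨z, hz, hmax⟩ := B.exists_max_image p h
    have hzk := (mem_filter.1 hz).2
    have t : ∀ y, topkErr k p y * (p y - p z) ≤ topkErr k g y * (p y - p z) := by
      intro y
      by_cases hy : k ≤ (univ.filter (fun j => p y < p j)).card
      · have e : topkErr k p y = 1 := by unfold topkErr; rw [if_pos hy]
        have := hmax y (by simp [hB, hy])
        rw [e]
        nlinarith [(herr y).2]
      · have e : topkErr k p y = 0 := by unfold topkErr; rw [if_neg hy]
        have : p z ≤ p y := by
          by_contra hlt
          push Not at hlt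
          apply hy
          refine hzk.trans (card_le_card ?_)
          intro j hj
          simp only [mem_filter, mem_univ, true_and] at hj ⊢
          exact hlt.trans hj
        rw [e]
        nlinarith [(herr y).1]
    have hs : ∑ y, topkErr k p y ≤ ∑ y, topkErr k g y := by
      rw [aux_sum, aux_sum]
      have c1 := card_filter_add_card_filter_not (s := (univ : Finset (Fin m)))
        (fun y => k ≤ (univ.filter (fun j => g y < g j)).card)
      have c2 := card_filter_add_card_filter_not (s := (univ : Finset (Fin m)))
        (fun y => k ≤ (univ.filter (fun j => p y < p j)).card)
      have c3 := aux_upper k hk g hg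
      have c4 : (univ.filter (fun j => p z < p j)).card ≤
          (univ.filter (fun y => ¬ k ≤ (univ.filter (fun j => p y < p j)).card)).card := by
        apply card_le_card
        intro j hj
        simp only [mem_filter, mem_univ, true_and] at hj ⊢
        intro hjk
        have := hmax j (by simp [hB, hjk])
        linarith
      norm_cast
      omega
    have ht := sum_le_sum (fun y (_ : y ∈ (univ : Finset (Fin m))) => t y)
    simp only [mul_sub, sum_sub_distrib, ← sum_mul] at ht
    nlinarith [mul_le_mul_of_nonneg_right hs (hp z)]

theorem stmt_3 (m : ℕ) (hm : 2 ≤ m) :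
    (∀ p ∈ Set.Ioo (0:ℝ) 1,
      (∀ α : ℝ, logRisk p (Real.log (p / (1 - p))) ≤ logRisk p α) ∧
      (∀ α : ℝ, logRisk p α = logRisk p (Real.log (p / (1 - p))) →
        α = Real.log (p / (1 - p)))) ∧
    StrictMonoOn (fun p : ℝ => Real.log (p / (1 - p))) (Set.Ioo 0 1) ∧
    (∀ k : ℕ, 1 ≤ k → k ≤ m →
      ∀ p : Fin m → ℝ, (∀ y, 0 ≤ p y) → (∑ y, p y = 1) →
        (∀ y, p y ∈ Set.Ioo (0:ℝ) 1) → Function.Injective p →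
        ∀ g' : Fin m → ℝ, Function.Injective g' →
          ∑ y, topkErr k (fun y => Real.log (p y / (1 - p y))) y * p y ≤
            ∑ y, topkErr k g' y * p y) := by
  refine ⟨fun p hp => ⟨fun α => ?_, fun α h => ?_⟩, aux_mono, ?_⟩
  · by_cases hα : α = Real.log (p / (1 - p))
    · rw [hα]
    · exact (aux_strict p hp α hα).le
  · by_contra hα
    exact absurd h (aux_strict p hp α hα).ne'
  · intro k hk _ p hp _ hp1 _ g hg
    have e : ∀ y, topkErr k (fun y => Real.log (p y / (1 - p y))) y = topkErr k p y := by
      intro y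
      have : ∀ j, Real.log (p y / (1 - p y)) < Real.log (p j / (1 - p j)) ↔ p y < p j :=
        fun j => aux_mono.lt_iff_lt (hp1 y) (hp1 j)
      unfold topkErr
      simp only [this]
    simp only [e]
    exact aux_topk k hk p hp g hg
end

section
/- Let γ > 0 and define the smooth binary hinge loss L_γ(α) = 1 − α − γ/2 if α < 1 − γ, L_γ(α) = (α − 1)²/(2γ) if 1 − γ ≤ α ≤ 1, and L_γ(α) = 0 if α > 1; equivalently, L_γ(α) = sup_{−1 ≤ β ≤ 0} { αβ − β − (γ/2)β² }. For p ∈ (0,1), let R_p(α) = L_γ(α)·p + L_γ(−α)·(1 − p). Then R_p attains its minimum at f*(p) given as follows. If 0 < γ ≤ 1: f*(p) = 1 − γ(1−p)/p when p ≥ 1/2, and f*(p) = −1 + γ·p/(1−p) when p < 1/2. If γ > 1: f*(p) = 1 − γ(1−p)/p when p ≥ γ/2, f*(p) = 2p − 1 when 1 − γ/2 ≤ p ≤ γ/2, and f*(p) = −1 + γ·p/(1−p) when p < 1 − γ/2. In all cases f* is a strictly monotonically increasing function of p on (0,1); consequently, the one-vs-all scheme with the smooth binary hinge loss is top-k calibrated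 for all 1 ≤ k ≤ m. -/
open Finset

/-- The smooth binary hinge loss with smoothing parameter `γ`. -/
noncomputable def smoothHinge (γ α : ℝ) : ℝ :=
  if α < 1 - γ then 1 - α - γ / 2
  else if α ≤ 1 then (α - 1) ^ 2 / (2 * γ)
  else 0

/-- The Bayes optimal score for the smooth binary hinge loss at class-1 probability `p`. -/
noncomputable def fstar (γ p : ℝ) : ℝ :=
  if γ ≤ 1 then
    (if 1 / 2 ≤ p then 1 - γ * (1 - p) / p else -1 + γ * p / (1 - p))
  else
    (if γ / 2 ≤ p then 1 - γ * (1 - p) / p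
     else if 1 - γ / 2 ≤ p then 2 * p - 1
     else -1 + γ * p / (1 - p))

lemma hinge_ge (γ : ℝ) (hγ : 0 < γ) (α β : ℝ) (h1 : -1 ≤ β) (h2 : β ≤ 0) :
    α * β - β - γ / 2 * β ^ 2 ≤ smoothHinge γ α := by
  unfold smoothHinge
  split_ifs with h h'
  · nlinarith [mul_nonneg (by linarith : 0 ≤ β + 1) (by linarith : 0 ≤ 1 - γ - α),
      mul_nonneg hγ.le (sq_nonneg (β + 1))]
  · rw [le_div_iff₀ (by positivity)]
    nlinarith [sq_nonneg (α - 1 - γ * β)]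
  · nlinarith [mul_nonneg (by linarith : 0 ≤ -β) (by linarith : 0 ≤ α - 1),
      mul_nonneg hγ.le (sq_nonneg β)]

lemma hinge_low (γ : ℝ) (hγ : 0 < γ) (α : ℝ) (h : α ≤ 1 - γ) :
    smoothHinge γ α = α * (-1) - (-1) - γ / 2 * (-1) ^ 2 := by
  rcases h.lt_or_eq with h | h
  · simp only [smoothHinge, if_pos h]; ring
  · subst h
    have : 1 - γ ≤ 1 := by linarith
    simp only [smoothHinge, lt_irrefl, if_false, if_pos this]
    field_simp; ring

lemma hinge_mid (γ : ℝ) (hγ : 0 < γ) (α β : ℝ) (h1 : -1 ≤ β) (h2 : β ≤ 0)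
    (h : α = 1 + γ * β) :
    smoothHinge γ α = α * β - β - γ / 2 * β ^ 2 := by
  subst h
  have a : ¬ (1 + γ * β < 1 - γ) := by nlinarith
  have b : 1 + γ * β ≤ 1 := by nlinarith
  simp only [smoothHinge, if_neg a, if_pos b]
  field_simp; ring

lemma hinge_high (γ : ℝ) (hγ : 0 < γ) (α : ℝ) (h : 1 < α) : smoothHinge γ α = 0 := by
  unfold smoothHinge
  rw [if_neg (by linarith), if_neg (by linarith)]

lemma hinge_sup (γ : ℝ) (hγ : 0 < γ) (α : ℝ) : smoothHinge γ α =
      sSup {v : ℝ | ∃ β : ℝ, -1 ≤ β ∧ β ≤ 0 ∧ v = α * β - β - γ / 2 * β ^ 2} := by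
  symm
  apply IsGreatest.csSup_eq
  refine ⟨?_, ?_⟩
  · by_cases h : α ≤ 1 - γ
    · exact ⟨-1, le_refl _, by norm_num, hinge_low γ hγ α h⟩
    · by_cases h' : α ≤ 1
      · have a : -1 ≤ (α - 1) / γ := by rw [le_div_iff₀ hγ]; linarith
        have b : (α - 1) / γ ≤ 0 := div_nonpos_of_nonpos_of_nonneg (by linarith) hγ.le
        exact ⟨(α - 1) / γ, a, b, hinge_mid γ hγ α _ a b (by field_simp; ring)⟩
      · exact ⟨0, by norm_num, le_refl _, by rw [hinge_high γ hγ α (by linarith)]; ring⟩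
  · rintro v ⟨β, h1, h2, rfl⟩
    exact hinge_ge γ hγ α β h1 h2

lemma min_crit (γ : ℝ) (hγ : 0 < γ) (p : ℝ) (hp0 : 0 < p) (hp1 : p < 1) (a β₁ β₂ : ℝ)
    (h1 : -1 ≤ β₁) (h1' : β₁ ≤ 0) (h2 : -1 ≤ β₂) (h2' : β₂ ≤ 0)
    (hb : p * β₁ = (1 - p) * β₂)
    (e1 : smoothHinge γ a = a * β₁ - β₁ - γ / 2 * β₁ ^ 2)
    (e2 : smoothHinge γ (-a) = (-a) * β₂ - β₂ - γ / 2 * β₂ ^ 2) (α : ℝ) :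
    smoothHinge γ a * p + smoothHinge γ (-a) * (1 - p) ≤
        smoothHinge γ α * p + smoothHinge γ (-α) * (1 - p) := by
  have i1 := mul_le_mul_of_nonneg_right (hinge_ge γ hγ α β₁ h1 h1') hp0.le
  have i2 := mul_le_mul_of_nonneg_right (hinge_ge γ hγ (-α) β₂ h2 h2') (by linarith : 0 ≤ 1 - p)
  rw [e1, e2]
  refine le_trans (le_of_eq ?_) (add_le_add i1 i2)
  linear_combination (a - α) * hb

lemma min_hi (γ : ℝ) (hγ : 0 < γ) (p : ℝ) (hp0 : 0 < p) (hp1 : p < 1) (h : 1 / 2 ≤ p)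
    (h' : γ / 2 ≤ p) (α : ℝ) :
    smoothHinge γ (1 - γ * (1 - p) / p) * p + smoothHinge γ (-(1 - γ * (1 - p) / p)) * (1 - p) ≤
        smoothHinge γ α * p + smoothHinge γ (-α) * (1 - p) := by
  have a : -1 ≤ -((1 - p) / p) := by
    rw [neg_le_neg_iff, div_le_one hp0]; linarith
  have b : -((1 - p) / p) ≤ 0 := by
    have : 0 ≤ (1 - p) / p := div_nonneg (by linarith) hp0.le
    linarith
  refine min_crit γ hγ p hp0 hp1 _ (-((1 - p) / p)) (-1) a b le_rfl (by norm_num)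
    (by field_simp) (hinge_mid γ hγ _ _ a b (by ring)) (hinge_low γ hγ _ ?_) α
  have : γ * (1 - p) / p ≤ 2 - γ := by
    rw [div_le_iff₀ hp0]; linarith
  linarith

lemma min_lo (γ : ℝ) (hγ : 0 < γ) (p : ℝ) (hp0 : 0 < p) (hp1 : p < 1) (h : p ≤ 1 / 2)
    (h' : p ≤ 1 - γ / 2) (α : ℝ) :
    smoothHinge γ (-1 + γ * p / (1 - p)) * p + smoothHinge γ (-(-1 + γ * p / (1 - p))) * (1 - p) ≤
        smoothHinge γ α * p + smoothHinge γ (-α) * (1 - p) := by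
  have := min_hi γ hγ (1 - p) (by linarith) (by linarith) (by linarith) (by linarith) (-α)
  have e : 1 - γ * (1 - (1 - p)) / (1 - p) = -(-1 + γ * p / (1 - p)) := by ring
  rw [e, neg_neg, neg_neg, sub_sub_cancel] at this
  linarith

lemma min_center (γ : ℝ) (hγ : 0 < γ) (p : ℝ) (hp0 : 0 < p) (hp1 : p < 1) (h : p ≤ γ / 2)
    (h' : 1 - γ / 2 ≤ p) (α : ℝ) :
    smoothHinge γ (2 * p - 1) * p + smoothHinge γ (-(2 * p - 1)) * (1 - p) ≤
        smoothHinge γ α * p + smoothHinge γ (-α) * (1 - p) := by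
  have a : -1 ≤ (2 * p - 2) / γ := by rw [le_div_iff₀ hγ]; linarith
  have b : (2 * p - 2) / γ ≤ 0 := div_nonpos_of_nonpos_of_nonneg (by linarith) hγ.le
  have c : -1 ≤ (-2 * p) / γ := by rw [le_div_iff₀ hγ]; linarith
  have d : (-2 * p) / γ ≤ 0 := div_nonpos_of_nonpos_of_nonneg (by linarith) hγ.le
  exact min_crit γ hγ p hp0 hp1 _ _ _ a b c d (by field_simp; ring)
    (hinge_mid γ hγ _ _ a b (by field_simp; ring)) (hinge_mid γ hγ _ _ c d (by field_simp; ring)) α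

lemma fstar_min (γ : ℝ) (hγ : 0 < γ) (p : ℝ) (hp0 : 0 < p) (hp1 : p < 1) (α : ℝ) :
    smoothHinge γ (fstar γ p) * p + smoothHinge γ (-(fstar γ p)) * (1 - p) ≤
        smoothHinge γ α * p + smoothHinge γ (-α) * (1 - p) := by
  unfold fstar
  split_ifs
  · exact min_hi γ hγ p hp0 hp1 (by linarith) (by linarith) α
  · exact min_lo γ hγ p hp0 hp1 (by linarith) (by linarith) α
  · exact min_hi γ hγ p hp0 hp1 (by linarith) (by linarith) α
  · exact min_center γ hγ p hp0 hp1 (by linarith) (by linarith) α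
  · exact min_lo γ hγ p hp0 hp1 (by linarith) (by linarith) α

lemma fstar_mono (γ : ℝ) (hγ : 0 < γ) : StrictMonoOn (fstar γ) (Set.Ioo 0 1) := by
  rintro p ⟨hp0, hp1⟩ q ⟨hq0, hq1⟩ hpq
  have hp1' : 0 < 1 - p := by linarith
  have hq1' : 0 < 1 - q := by linarith
  have H : γ * (1 - q) / q < γ * (1 - p) / p := by
    rw [div_lt_div_iff₀ hq0 hp0]; nlinarith
  have L : γ * p / (1 - p) < γ * q / (1 - q) := by
    rw [div_lt_div_iff₀ hp1' hq1']; nlinarith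
  have Q1 : 1 / 2 ≤ q → γ * (1 - q) / q ≤ γ := fun h => by
    rw [div_le_iff₀ hq0]; nlinarith
  have P1 : p < 1 / 2 → γ * p / (1 - p) < γ := fun h => by
    rw [div_lt_iff₀ hp1']; nlinarith
  have Q2 : γ / 2 ≤ q → γ * (1 - q) / q ≤ 2 * (1 - q) := fun h => by
    rw [div_le_iff₀ hq0]; nlinarith
  have P2 : p < 1 - γ / 2 → γ * p / (1 - p) ≤ 2 * p := fun h => by
    rw [div_le_iff₀ hp1']; nlinarith
  unfold fstar
  split_ifs with h1 h2 h3 h4 h5 h6 h7 h8 h9 <;>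
    first
    | linarith
    | (have := Q1 (by assumption); have := P1 (by linarith); linarith)
    | (have := Q2 (by assumption); linarith)
    | (have := P2 (by linarith); linarith)
    | (have := Q2 (by assumption); have := P2 (by linarith); linarith)

lemma card_top {m : ℕ} (k : ℕ) (hk : k ≤ m) (g : Fin m → ℝ) (hg : Function.Injective g) :
    (univ.filter (fun y => ¬ k ≤ (univ.filter (fun j => g y < g j)).card)).card = k := by
  set r : Fin m → ℕ := fun y => (univ.filter (fun j => g y < g j)).card with hr
  have hlt : ∀ y y', g y < g y' → r y' < r y := by
    intro y y' h
    apply Finset.card_lt_card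
    rw [Finset.ssubset_iff_of_subset]
    · exact ⟨y', by simpa using h, by simp⟩
    · intro j; simp only [mem_filter, mem_univ, true_and]; exact fun h' => h.trans h'
  have hinj : Function.Injective r := by
    intro y y' h
    by_contra hne
    rcases lt_or_gt_of_ne (fun e => hne (hg e)) with h' | h'
    · have := hlt _ _ h'; omega
    · have := hlt _ _ h'; omega
  have himg : univ.image r = range m := by
    apply Finset.eq_of_subset_of_card_le
    · intro n hn
      obtain ⟨y, -, rfl⟩ := Finset.mem_image.1 hn
      rw [Finset.mem_range]
      have : (univ.filter (fun j => g y < g j)).card < (univ : Finset (Fin m)).card := by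
        apply Finset.card_lt_card
        rw [Finset.ssubset_iff_of_subset (Finset.filter_subset _ _)]
        exact ⟨y, by simp, by simp⟩
      simpa using this
    · rw [Finset.card_image_of_injective _ hinj]; simp
  have : (univ.filter (fun y => ¬ k ≤ r y)).image r = range k := by
    ext n
    simp only [mem_image, mem_filter, mem_univ, true_and, mem_range, not_le]
    constructor
    · rintro ⟨y, h, rfl⟩; exact h
    · intro h
      have : n ∈ univ.image r := by rw [himg, mem_range]; omega
      obtain ⟨y, -, rfl⟩ := Finset.mem_image.1 this
      exact ⟨y, h, rfl⟩
  have h2 := congrArg Finset.card this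
  rwa [Finset.card_image_of_injective _ hinj, card_range] at h2

lemma err_eq {m : ℕ} (k : ℕ) (g p : Fin m → ℝ) :
    ∑ y, topkErr k g y * p y = ∑ y, p y -
      ∑ y ∈ univ.filter (fun y => ¬ k ≤ (univ.filter (fun j => g y < g j)).card), p y := by
  rw [Finset.sum_filter, ← Finset.sum_sub_distrib]
  apply Finset.sum_congr rfl
  intro y _
  unfold topkErr
  split_ifs <;> simp_all

lemma topk_opt {m : ℕ} (k : ℕ) (hk1 : 1 ≤ k) (hk : k ≤ m) (p g g' : Fin m → ℝ)
    (hg : Function.Injective g) (hg' : Function.Injective g')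
    (hmono : ∀ y z, p y < p z → g y < g z) :
    ∑ y, topkErr k g y * p y ≤ ∑ y, topkErr k g' y * p y := by
  rw [err_eq, err_eq]
  have c := card_top k hk g hg
  have c' := card_top k hk g' hg'
  set T := univ.filter (fun y => ¬ k ≤ (univ.filter (fun j => g y < g j)).card) with hT
  set T' := univ.filter (fun y => ¬ k ≤ (univ.filter (fun j => g' y < g' j)).card)
  have hne : T.Nonempty := by rw [← Finset.card_pos]; omega
  obtain ⟨t, ht, hmin⟩ := Finset.exists_min_image T p hne
  have hout : ∀ y, y ∉ T → p y ≤ p t := by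
    intro y hy
    by_contra h
    push Not at h
    apply hy
    have h1 := hmono _ _ h
    simp only [hT, mem_filter, mem_univ, true_and, not_le] at ht ⊢
    refine lt_of_le_of_lt (Finset.card_le_card ?_) ht
    intro j; simp only [mem_filter, mem_univ, true_and]; exact fun h' => h1.trans h'
  have key : ∑ y ∈ T', (p y - p t) ≤ ∑ y ∈ T, (p y - p t) := by
    have e1 : ∀ S : Finset (Fin m), ∑ y ∈ S, (p y - p t) =
        ∑ y, if y ∈ S then p y - p t else 0 := by
      intro S; simp
    rw [e1, e1]
    apply Finset.sum_le_sum
    intro y _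
    by_cases hy : y ∈ T
    · have := hmin y hy
      split_ifs <;> linarith
    · have := hout y hy
      split_ifs; linarith; exact le_rfl
  rw [Finset.sum_sub_distrib, Finset.sum_sub_distrib, Finset.sum_const, Finset.sum_const, c, c'] at key
  linarith

theorem stmt_4 (m : ℕ) (hm : 2 ≤ m) (γ : ℝ) (hγ : 0 < γ) :
    (∀ α : ℝ, smoothHinge γ α =
      sSup {v : ℝ | ∃ β : ℝ, -1 ≤ β ∧ β ≤ 0 ∧ v = α * β - β - γ / 2 * β ^ 2}) ∧
    (∀ p ∈ Set.Ioo (0:ℝ) 1, ∀ α : ℝ,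
      smoothHinge γ (fstar γ p) * p + smoothHinge γ (-(fstar γ p)) * (1 - p) ≤
        smoothHinge γ α * p + smoothHinge γ (-α) * (1 - p)) ∧
    StrictMonoOn (fstar γ) (Set.Ioo 0 1) ∧
    (∀ k : ℕ, 1 ≤ k → k ≤ m →
      ∀ p : Fin m → ℝ, (∀ y, 0 ≤ p y) → (∑ y, p y = 1) →
        (∀ y, p y ∈ Set.Ioo (0:ℝ) 1) → Function.Injective p →
        ∀ g' : Fin m → ℝ, Function.Injective g' →
          ∑ y, topkErr k (fun y => fstar γ (p y)) y * p y ≤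
            ∑ y, topkErr k g' y * p y) := by
  refine ⟨hinge_sup γ hγ, fun p hp α => fstar_min γ hγ p hp.1 hp.2 α, fstar_mono γ hγ, ?_⟩
  intro k hk1 hk p _ _ hp hinj g' hg'
  refine topk_opt k hk1 hk p _ g' ?_ hg' ?_
  · intro y z h
    exact hinj ((fstar_mono γ hγ).injOn (hp y) (hp z) h)
  · intro y z h
    exact fstar_mono γ hγ (hp y) (hp z) h
end

section
/- Fix m ≥ 2 and a probability vector p ∈ ℝ^m, and define the multiclass hinge (Crammer–Singer) pointwise risk R_p(g) = Σ_{l=1}^m [ max_{j} ( [j ≠ l] + g_j − g_l ) ]·p_l for g ∈ ℝ^m, where [j ≠ l] equals 1 if j ≠ l and 0 otherwise. Then inf_{g ∈ ℝ^m} R_p(g) = min{ 1, 2(1 − max_y p_y) }. Moreover, if max_y p_y < 1/2, then every constant vector g = c·(1,…,1), c ∈ ℝ, attains this infimum (with value 1); in particular the multiclass SVM loss is not top-k calibrated. -/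
open Finset

/-- Pointwise risk of the multiclass (Crammer–Singer) hinge loss at class
probabilities `p` and scores `g`. -/
noncomputable def mcHingeRisk {m : ℕ} (hm : 0 < m) (p g : Fin m → ℝ) : ℝ :=
  ∑ l, (Finset.univ.sup' ⟨⟨0, hm⟩, Finset.mem_univ _⟩
    (fun j => (if j ≠ l then (1:ℝ) else 0) + g j - g l)) * p l

theorem risk_const {m : ℕ} (hm0 : 0 < m) (hm : 2 ≤ m) (p : Fin m → ℝ) (hp1 : ∑ y, p y = 1)
    (c : ℝ) : mcHingeRisk hm0 p (fun _ => c) = 1 := by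
  unfold mcHingeRisk
  refine Eq.trans ?_ hp1
  apply Finset.sum_congr rfl
  intro l _
  have h : (Finset.univ.sup' ⟨⟨0, hm0⟩, Finset.mem_univ _⟩
      (fun j => (if j ≠ l then (1:ℝ) else 0) + c - c)) = 1 := by
    apply le_antisymm
    · apply Finset.sup'_le
      intro j _
      split_ifs <;> linarith
    · haveI : Nontrivial (Fin m) := Fin.nontrivial_iff_two_le.mpr hm
      obtain ⟨b, hb⟩ := exists_ne l
      refine le_trans ?_ (Finset.le_sup' _ (Finset.mem_univ b))
      simp [hb]
  exact (congrArg (fun x => x * p l) h).trans (one_mul _)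

theorem risk_single {m : ℕ} (hm0 : 0 < m) (p : Fin m → ℝ) (hp0 : ∀ y, 0 ≤ p y)
    (hp1 : ∑ y, p y = 1) (a : Fin m) :
    mcHingeRisk hm0 p (fun j => if j = a then 1 else 0) ≤ 2 * (1 - p a) := by
  have e : 2 * (1 - p a) = ∑ l, (if l = a then (0:ℝ) else 2) * p l := by
    have : ∀ l, (if l = a then (0:ℝ) else 2) * p l = 2 * p l - (if l = a then 2 * p l else 0) := by
      intro l; split_ifs <;> ring
    simp only [this, Finset.sum_sub_distrib, ← Finset.mul_sum, hp1]
    simp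
    ring
  rw [e]
  unfold mcHingeRisk
  apply Finset.sum_le_sum
  intro l _
  apply mul_le_mul_of_nonneg_right _ (hp0 l)
  apply Finset.sup'_le
  intro j _
  by_cases h1 : l = a <;> by_cases h2 : j = a <;> by_cases h3 : j = l <;> simp_all
  norm_num

theorem risk_lower {m : ℕ} (hm0 : 0 < m) (hm : 2 ≤ m) (p : Fin m → ℝ) (hp0 : ∀ y, 0 ≤ p y)
    (hp1 : ∑ y, p y = 1) (pmax : ℝ) (hmax : ∀ y, p y ≤ pmax) (g : Fin m → ℝ) :
    min 1 (2 * (1 - pmax)) ≤ mcHingeRisk hm0 p g := by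
  haveI : Nontrivial (Fin m) := Fin.nontrivial_iff_two_le.mpr hm
  obtain ⟨a, -, ha⟩ := Finset.exists_max_image (Finset.univ : Finset (Fin m)) g
    ⟨⟨0, hm0⟩, Finset.mem_univ _⟩
  obtain ⟨b', hb'⟩ := exists_ne a
  obtain ⟨b, hb, hbmax⟩ := Finset.exists_max_image (Finset.univ.erase a) g
    ⟨b', by simp [hb']⟩
  have hba : b ≠ a := Finset.ne_of_mem_erase hb
  obtain ⟨t, ht⟩ : ∃ t, t = g a - g b := ⟨_, rfl⟩
  have ht0 : 0 ≤ t := by have := ha b (Finset.mem_univ _); linarith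
  have key : ∑ l, (if l = a then max 0 (1 - t) else 1 + t) * p l ≤ mcHingeRisk hm0 p g := by
    unfold mcHingeRisk
    apply Finset.sum_le_sum
    intro l _
    apply mul_le_mul_of_nonneg_right _ (hp0 l)
    by_cases h : l = a
    · subst h
      rw [if_pos rfl]
      apply max_le
      · refine le_trans ?_ (Finset.le_sup' _ (Finset.mem_univ l))
        simp
      · refine le_trans ?_ (Finset.le_sup' _ (Finset.mem_univ b))
        rw [if_pos hba]; linarith
    · rw [if_neg h]
      refine le_trans ?_ (Finset.le_sup' _ (Finset.mem_univ a))
      rw [if_pos (Ne.symm h)]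
      have := hbmax l (by simp [h])
      linarith
  have e : ∑ l, (if l = a then max 0 (1 - t) else 1 + t) * p l
      = (1 + t) * (1 - p a) + max 0 (1 - t) * p a := by
    have : ∀ l, (if l = a then max 0 (1 - t) else 1 + t) * p l
        = (1 + t) * p l + (if l = a then (max 0 (1 - t) - (1 + t)) * p l else 0) := by
      intro l; split_ifs <;> ring
    simp only [this, Finset.sum_add_distrib, ← Finset.mul_sum, hp1]
    rw [Finset.sum_ite_eq' Finset.univ a, if_pos (Finset.mem_univ a)]
    ring
  rw [e] at key
  refine le_trans ?_ key
  have hpa := hmax a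
  have hpa1 : p a ≤ 1 := by
    rw [← hp1]; exact Finset.single_le_sum (fun i _ => hp0 i) (Finset.mem_univ a)
  have hpa0 := hp0 a
  rcases le_total t 1 with h | h
  · rw [max_eq_right (by linarith)]
    rcases le_total (p a) (1/2) with h2 | h2
    · refine le_trans (min_le_left _ _) ?_
      nlinarith
    · refine le_trans (min_le_right _ _) ?_
      nlinarith
  · rw [max_eq_left (by linarith)]
    refine le_trans (min_le_right _ _) ?_
    nlinarith

theorem stmt_5 (m : ℕ) (hm : 2 ≤ m)
    (p : Fin m → ℝ) (hp0 : ∀ y, 0 ≤ p y) (hp1 : ∑ y, p y = 1)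
    (pmax : ℝ) (hpmax : IsGreatest (Set.range p) pmax) :
    IsGLB {r : ℝ | ∃ g : Fin m → ℝ, r = mcHingeRisk (by omega) p g}
      (min 1 (2 * (1 - pmax))) ∧
    (pmax < 1/2 →
      min 1 (2 * (1 - pmax)) = 1 ∧
      ∀ c : ℝ, mcHingeRisk (by omega) p (fun _ => c) = min 1 (2 * (1 - pmax))) := by
  have hm0 : 0 < m := by omega
  obtain ⟨⟨a, ha⟩, hub⟩ := hpmax
  have hmax : ∀ y, p y ≤ pmax := fun y => hub ⟨y, rfl⟩
  refine ⟨⟨?_, ?_⟩, ?_⟩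
  · rintro r ⟨g, rfl⟩
    exact risk_lower hm0 hm p hp0 hp1 pmax hmax g
  · intro x hx
    apply le_min
    · have := hx ⟨fun _ => 0, rfl⟩
      rwa [risk_const hm0 hm p hp1 0] at this
    · have := hx ⟨fun j => if j = a then 1 else 0, rfl⟩
      rw [← ha]
      exact this.trans (risk_single hm0 p hp0 hp1 a)
  · intro h
    have h1 : min 1 (2 * (1 - pmax)) = 1 := min_eq_left (by linarith)
    refine ⟨h1, fun c => ?_⟩
    rw [h1]
    exact risk_const hm0 hm p hp1 c
end

section
/- Fix m ≥ 2 and a probability vector p ∈ ℝ^m with p_y > 0 for all y. For the softmax (multinomial logistic) pointwise risk R_p(g) = Σ_{y=1}^m [ log( Σ_{j=1}^m exp(g_j) ) − g_y ]·p_y over g ∈ ℝ^m, a vector g minimizes R_p if and only if there exists c ∈ ℝ such that g_y = c + log p_y for all y. In particular every minimizer preserves the ranking of the components of p, so the softmax loss is top-k calibrated for all 1 ≤ k ≤ m. -/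
open Finset

/-- Pointwise risk of the softmax (multinomial logistic) loss at class
probabilities `p` and scores `g`. -/
noncomputable def softmaxRisk {m : ℕ} (p g : Fin m → ℝ) : ℝ :=
  ∑ y, (Real.log (∑ j, Real.exp (g j)) - g y) * p y

theorem softmaxRisk_decomp {m : ℕ} (p : Fin m → ℝ) (hp0 : ∀ y, 0 < p y) (hp1 : ∑ y, p y = 1)
    (g : Fin m → ℝ) :
    softmaxRisk p g = ∑ y, -(Real.log (p y) * p y) +
      ∑ y, p y * (Real.exp (g y - Real.log (∑ j, Real.exp (g j)) - Real.log (p y)) - 1 -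
        (g y - Real.log (∑ j, Real.exp (g j)) - Real.log (p y))) := by
  have hne : (Finset.univ : Finset (Fin m)).Nonempty := by
    by_contra h
    rw [Finset.not_nonempty_iff_eq_empty] at h
    rw [h] at hp1
    simp at hp1
  have hS : 0 < ∑ j, Real.exp (g j) := Finset.sum_pos (fun j _ => Real.exp_pos _) hne
  have h1 : ∑ y, (Real.exp (g y) / (∑ j, Real.exp (g j)) - p y) = 0 := by
    rw [Finset.sum_sub_distrib, ← Finset.sum_div, div_self hS.ne', hp1, sub_self]
  have h2 : ∀ y, p y * (Real.exp (g y - Real.log (∑ j, Real.exp (g j)) - Real.log (p y)) - 1 -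
        (g y - Real.log (∑ j, Real.exp (g j)) - Real.log (p y))) =
      (Real.exp (g y) / (∑ j, Real.exp (g j)) - p y) +
        ((Real.log (∑ j, Real.exp (g j)) - g y) * p y + Real.log (p y) * p y) := by
    intro y
    have hy := (hp0 y).ne'
    rw [Real.exp_sub, Real.exp_sub, Real.exp_log hS, Real.exp_log (hp0 y)]
    field_simp
    ring
  rw [Finset.sum_congr rfl (fun y _ => h2 y), Finset.sum_add_distrib, h1,
    Finset.sum_add_distrib, Finset.sum_neg_distrib, softmaxRisk]
  ring

theorem stmt_6 (m : ℕ) (hm : 2 ≤ m)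
    (p : Fin m → ℝ) (hp0 : ∀ y, 0 < p y) (hp1 : ∑ y, p y = 1) :
    (∀ g : Fin m → ℝ,
      (∀ g' : Fin m → ℝ, softmaxRisk p g ≤ softmaxRisk p g') ↔
        ∃ c : ℝ, ∀ y, g y = c + Real.log (p y)) ∧
    (∀ g : Fin m → ℝ, (∀ g' : Fin m → ℝ, softmaxRisk p g ≤ softmaxRisk p g') →
      ∀ i j : Fin m, p i < p j → g i < g j) := by
  have key : ∀ g : Fin m → ℝ,
      (∀ g' : Fin m → ℝ, softmaxRisk p g ≤ softmaxRisk p g') ↔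
        ∃ c : ℝ, ∀ y, g y = c + Real.log (p y) := by
    have hnn : ∀ t : ℝ, 0 ≤ Real.exp t - 1 - t := fun t => by
      linarith [Real.add_one_le_exp t]
    have hlow : ∀ g' : Fin m → ℝ, ∑ y, -(Real.log (p y) * p y) ≤ softmaxRisk p g' := by
      intro g'
      rw [softmaxRisk_decomp p hp0 hp1 g']
      exact le_add_of_nonneg_right
        (Finset.sum_nonneg fun y _ => mul_nonneg (hp0 y).le (hnn _))
    have heq : ∀ (c : ℝ) (g : Fin m → ℝ), (∀ y, g y = c + Real.log (p y)) →
        softmaxRisk p g = ∑ y, -(Real.log (p y) * p y) := by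
      intro c g hg
      have hL : Real.log (∑ j, Real.exp (g j)) = c := by
        have : ∀ j, Real.exp (g j) = Real.exp c * p j := fun j => by
          rw [hg, Real.exp_add, Real.exp_log (hp0 j)]
        rw [Finset.sum_congr rfl (fun j _ => this j), ← Finset.mul_sum, hp1, mul_one, Real.log_exp]
      rw [softmaxRisk, hL]
      refine Finset.sum_congr rfl fun y _ => ?_
      rw [hg]
      ring
    intro g
    constructor
    · intro hmin
      refine ⟨Real.log (∑ j, Real.exp (g j)), fun y => ?_⟩
      have h := hmin (fun y => 0 + Real.log (p y))
      rw [heq 0 _ (fun _ => rfl), softmaxRisk_decomp p hp0 hp1 g] at h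
      have hz := le_antisymm (by linarith)
        (Finset.sum_nonneg fun y (_ : y ∈ Finset.univ) => mul_nonneg (hp0 y).le
          (hnn (g y - Real.log (∑ j, Real.exp (g j)) - Real.log (p y))))
      rw [Finset.sum_eq_zero_iff_of_nonneg
        (fun y _ => mul_nonneg (hp0 y).le (hnn _))] at hz
      have hy := (mul_eq_zero.mp (hz y (Finset.mem_univ y))).resolve_left (hp0 y).ne'
      by_contra hne
      have := Real.add_one_lt_exp
        (x := g y - Real.log (∑ j, Real.exp (g j)) - Real.log (p y))
        (fun h0 => hne (by linarith))
      linarith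
    · rintro ⟨c, hc⟩ g'
      rw [heq c g hc]
      exact hlow g'
  refine ⟨key, fun g hg i j hij => ?_⟩
  obtain ⟨c, hc⟩ := (key g).mp hg
  rw [hc i, hc j]
  linarith [Real.log_lt_log (hp0 i) hij]
end

section
/- Let γ > 0, d ≥ 1, and 1 ≤ k ≤ d. For every b ∈ ℝ^d, sup_{x ∈ Δ^α_k(1)} { ⟨b, x⟩ − (γ/2)‖x‖² } = (1/γ)( ⟨b, p⟩ − (1/2)‖p‖² ), where p is the Euclidean projection of b onto Δ^α_k(γ). Moreover, the function b ↦ (1/γ)( ⟨b, p(b)⟩ − (1/2)‖p(b)‖² ) is convex and differentiable on ℝ^d with gradient (1/γ)·p(b), and this gradient is Lipschitz continuous with constant 1/γ (i.e., the smooth top-k hinge loss is (1/γ)-smooth). -/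
open Finset
open scoped RealInnerProductSpace

section aux
variable {E : Type*} [NormedAddCommGroup E] [InnerProductSpace ℝ E]

theorem aux_var (C : Set E) (hC : Convex ℝ C) (b p : E) (hp : p ∈ C)
    (h : ∀ x ∈ C, ‖b - p‖ ≤ ‖b - x‖) : ∀ y ∈ C, ⟪b - p, y - p⟫ ≤ 0 := by
  refine (norm_eq_iInf_iff_real_inner_le_zero hC hp).1 ?_
  haveI : Nonempty C := ⟨⟨p, hp⟩⟩
  apply le_antisymm
  · exact le_ciInf fun w => h w w.2
  · exact ciInf_le (f := fun w : C => ‖b - (w : E)‖)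
      ⟨0, by rintro _ ⟨w, rfl⟩; exact norm_nonneg _⟩ ⟨p, hp⟩

theorem aux_max (b p x : E) (h : ‖b - p‖ ≤ ‖b - x‖) :
    ⟪b, x⟫ - (1/2) * ‖x‖^2 ≤ ⟪b, p⟫ - (1/2) * ‖p‖^2 := by
  have h2 : ‖b - p‖^2 ≤ ‖b - x‖^2 := by gcongr
  rw [norm_sub_sq_real, norm_sub_sq_real] at h2
  linarith

theorem aux_mono_s9 (b c p q : E) (h1 : ⟪b - p, q - p⟫ ≤ 0) (h2 : ⟪c - q, p - q⟫ ≤ 0) :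
    ‖p - q‖ ≤ ‖b - c‖ := by
  have h3 : ‖p - q‖^2 ≤ ⟪b - c, p - q⟫ := by
    rw [← real_inner_self_eq_norm_sq]
    simp only [inner_sub_left, inner_sub_right] at *
    linarith [real_inner_comm p q]
  have h4 := real_inner_le_norm (b - c) (p - q)
  rcases (norm_nonneg (p - q)).eq_or_lt with h0 | h0
  · rw [← h0]; exact norm_nonneg _
  · nlinarith

theorem aux_all (C : Set E) [CompleteSpace E] (hC : Convex ℝ C) (P : E → E) (hP : ∀ b, P b ∈ C)
    (hd : ∀ b, ∀ x ∈ C, ‖b - P b‖ ≤ ‖b - x‖) (γ : ℝ) (hγ : 0 < γ) :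
    ConvexOn ℝ Set.univ (fun b : E => (1/γ) * (⟪b, P b⟫ - (1/2) * ‖P b‖^2)) ∧
    (∀ b, HasGradientAt (fun b : E => (1/γ) * (⟪b, P b⟫ - (1/2) * ‖P b‖^2))
        ((1/γ) • P b) b) ∧
    LipschitzWith (1/γ).toNNReal (fun b => (1/γ) • P b) := by
  have hm : ∀ b c, ‖P b - P c‖ ≤ ‖b - c‖ := fun b c =>
    aux_mono_s9 b c _ _ (aux_var C hC b _ (hP b) (hd b) _ (hP c))
      (aux_var C hC c _ (hP c) (hd c) _ (hP b))
  have hg : 0 < 1/γ := by positivity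
  refine ⟨⟨convex_univ, ?_⟩, ?_, ?_⟩
  · intro x _ y _ s t hs ht hst
    have h1 := aux_max x (P x) _ (hd x _ (hP (s • x + t • y)))
    have h2 := aux_max y (P y) _ (hd y _ (hP (s • x + t • y)))
    simp only [smul_eq_mul]
    generalize P (s • x + t • y) = q at *
    rw [inner_add_left, real_inner_smul_left, real_inner_smul_left]
    have h3 := mul_le_mul_of_nonneg_left h1 hs
    have h4 := mul_le_mul_of_nonneg_left h2 ht
    have h5 : s * ⟪x, q⟫ + t * ⟪y, q⟫ - 1/2 * ‖q‖^2 =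
      s * (⟪x, q⟫ - 1/2 * ‖q‖^2) + t * (⟪y, q⟫ - 1/2 * ‖q‖^2) := by
      linear_combination (1/2 * ‖q‖^2) * hst
    rw [h5]
    have := mul_le_mul_of_nonneg_left (add_le_add h3 h4) hg.le
    linarith
  · intro b
    rw [hasGradientAt_iff_isLittleO]
    have hO : (fun c => (1/γ) * (⟪c, P c⟫ - (1/2) * ‖P c‖^2)
        - (1/γ) * (⟪b, P b⟫ - (1/2) * ‖P b‖^2) - ⟪(1/γ) • P b, c - b⟫)
        =O[nhds b] (fun c => ‖c - b‖^2) := by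
      refine Asymptotics.IsBigO.of_bound (1/γ) (Filter.Eventually.of_forall fun c => ?_)
      have h1 := aux_max c (P c) _ (hd c _ (hP b))
      have h2 := aux_max b (P b) _ (hd b _ (hP c))
      have h3 := real_inner_le_norm (c - b) (P c - P b)
      have h4 : ‖c - b‖ * ‖P c - P b‖ ≤ ‖c - b‖ * ‖c - b‖ := by
        gcongr; exact hm c b
      have e : (1/γ) * (⟪c, P c⟫ - (1/2) * ‖P c‖^2)
        - (1/γ) * (⟪b, P b⟫ - (1/2) * ‖P b‖^2) - ⟪(1/γ) • P b, c - b⟫ =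
        (1/γ) * ((⟪c, P c⟫ - (1/2) * ‖P c‖^2) - (⟪b, P b⟫ - (1/2) * ‖P b‖^2)
          - ⟪c - b, P b⟫) := by
        rw [real_inner_smul_left, real_inner_comm (c - b) (P b)]; ring
      rw [e, norm_mul, Real.norm_of_nonneg hg.le, norm_pow, norm_norm]
      gcongr
      simp only [inner_sub_left, inner_sub_right] at *
      rw [Real.norm_eq_abs, abs_le]
      constructor
      · nlinarith [sq_nonneg ‖c - b‖]
      · nlinarith
    refine hO.trans_isLittleO ?_
    exact Asymptotics.isLittleO_pow_sub_sub b one_lt_two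
  · refine LipschitzWith.of_dist_le_mul fun x y => ?_
    rw [dist_eq_norm, dist_eq_norm, ← smul_sub, norm_smul, Real.norm_of_nonneg hg.le,
      Real.coe_toNNReal _ hg.le]
    gcongr
    exact hm x y

end aux

theorem stmt_9 (d k : ℕ) (hd : 1 ≤ d) (hk1 : 1 ≤ k) (hkd : k ≤ d)
    (γ : ℝ) (hγ : 0 < γ)
    -- `P b` is the Euclidean projection of `b` onto the top-k simplex `Δ^α_k(γ)`
    (P : EuclideanSpace ℝ (Fin d) → EuclideanSpace ℝ (Fin d))
    (hPmem : ∀ b, (∑ i, P b i ≤ γ ∧ ∀ j, 0 ≤ P b j ∧ P b j ≤ (1/(k:ℝ)) * ∑ i, P b i))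
    (hPdist : ∀ b x, (∑ i, x i ≤ γ ∧ ∀ j, 0 ≤ x j ∧ x j ≤ (1/(k:ℝ)) * ∑ i, x i) →
      ‖b - P b‖ ≤ ‖b - x‖) :
    (∀ b, IsLUB {r : ℝ | ∃ x : EuclideanSpace ℝ (Fin d),
        ((∑ i, x i ≤ 1) ∧ ∀ j, 0 ≤ x j ∧ x j ≤ (1/(k:ℝ)) * ∑ i, x i) ∧
        r = ⟪b, x⟫ - γ/2 * ‖x‖^2}
      ((1/γ) * (⟪b, P b⟫ - (1/2) * ‖P b‖^2))) ∧
    ConvexOn ℝ Set.univ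
      (fun b : EuclideanSpace ℝ (Fin d) => (1/γ) * (⟪b, P b⟫ - (1/2) * ‖P b‖^2)) ∧
    (∀ b, HasGradientAt
        (fun b : EuclideanSpace ℝ (Fin d) => (1/γ) * (⟪b, P b⟫ - (1/2) * ‖P b‖^2))
        ((1/γ) • P b) b) ∧
    LipschitzWith (1/γ).toNNReal (fun b => (1/γ) • P b) := by
  have hC : Convex ℝ {x : EuclideanSpace ℝ (Fin d) |
      ∑ i, x i ≤ γ ∧ ∀ j, 0 ≤ x j ∧ x j ≤ (1/(k:ℝ)) * ∑ i, x i} := by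
    rintro x ⟨hx, hx'⟩ y ⟨hy, hy'⟩ s t hs ht hst
    have e : ∑ i, (s • x + t • y) i = s * ∑ i, x i + t * ∑ i, y i := by
      simp [Finset.sum_add_distrib, Finset.mul_sum]
    refine ⟨?_, fun j => ?_⟩
    · rw [e]
      have : s * γ + t * γ = γ := by rw [← add_mul, hst, one_mul]
      have := mul_le_mul_of_nonneg_left hx hs
      have := mul_le_mul_of_nonneg_left hy ht
      linarith
    · rw [e]
      have e2 : (s • x + t • y) j = s * x j + t * y j := by simp
      rw [e2]
      have := mul_le_mul_of_nonneg_left (hx' j).1 hs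
      have := mul_le_mul_of_nonneg_left (hy' j).1 ht
      have := mul_le_mul_of_nonneg_left (hx' j).2 hs
      have := mul_le_mul_of_nonneg_left (hy' j).2 ht
      constructor <;> linarith
  refine ⟨fun b => ⟨?_, fun u hu => hu ?_⟩, aux_all _ hC P hPmem hPdist γ hγ⟩
  · rintro _ ⟨x, ⟨hx, hx'⟩, rfl⟩
    have e : ∑ i, (γ • x) i = γ * ∑ i, x i := by simp [Finset.mul_sum]
    have h := aux_max b (P b) (γ • x) (hPdist b _ ?_)
    · rw [real_inner_smul_right, norm_smul, Real.norm_of_nonneg hγ.le] at h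
      have h2 := mul_le_mul_of_nonneg_left h (by positivity : 0 ≤ 1/γ)
      refine le_trans (le_of_eq ?_) h2
      field_simp
    · rw [e]
      refine ⟨by nlinarith, fun j => ?_⟩
      have e2 : (γ • x) j = γ * x j := by simp
      rw [e2]
      have := mul_le_mul_of_nonneg_left (hx' j).1 hγ.le
      have := mul_le_mul_of_nonneg_left (hx' j).2 hγ.le
      constructor <;> linarith
  · have hg : 0 ≤ 1/γ := by positivity
    obtain ⟨hp, hp'⟩ := hPmem b
    have e : ∑ i, ((1/γ) • P b) i = (1/γ) * ∑ i, P b i := by simp [Finset.mul_sum]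
    refine ⟨(1/γ) • P b, ⟨?_, fun j => ?_⟩, ?_⟩
    · rw [e]
      have := mul_le_mul_of_nonneg_left hp hg
      rwa [one_div_mul_cancel hγ.ne'] at this
    · rw [e]
      have e2 : ((1/γ) • P b) j = (1/γ) * P b j := by simp
      rw [e2]
      have := mul_le_mul_of_nonneg_left (hp' j).1 hg
      have := mul_le_mul_of_nonneg_left (hp' j).2 hg
      constructor <;> linarith
    · rw [real_inner_smul_right, norm_smul, Real.norm_of_nonneg hg]
      field_simp
end

section
/- Fix m ≥ 2 and a label y ∈ {1,…,m}. Define the softmax loss L : ℝ^m → ℝ by L(u) = log( Σ_{j=1}^m exp(u_j − u_y) ). Then for every v ∈ ℝ^m: sup_{u ∈ ℝ^m} { ⟨u, v⟩ − L(u) } = Σ_{j ≠ y} v_j log v_j + (1 + v_y) log(1 + v_y) if ⟨1, v⟩ = 0, v_j ≥ 0 for all j ≠ y, and Σ_{j ≠ y} v_j ≤ 1 (with the convention 0·log 0 = 0); and the supremum equals +∞ otherwise. -/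
open Finset

theorem gibbs_upper {m : ℕ} (hm : 0 < m) (p u : Fin m → ℝ) (hp : ∀ j, 0 ≤ p j)
    (hs : ∑ j, p j = 1) :
    (∑ j, u j * p j) - Real.log (∑ j, Real.exp (u j)) ≤ ∑ j, p j * Real.log (p j) := by
  have : Nonempty (Fin m) := ⟨⟨0, hm⟩⟩
  set S := ∑ j, Real.exp (u j) with hS
  have hSpos : 0 < S := Finset.sum_pos (fun j _ => Real.exp_pos _) univ_nonempty
  have key : ∀ j, p j * (u j - Real.log S) - p j * Real.log (p j)
      ≤ Real.exp (u j) / S - p j := by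
    intro j
    rcases (hp j).eq_or_lt with h | h
    · rw [← h]
      have : 0 < Real.exp (u j) / S := by positivity
      simpa using this.le
    · have h1 := Real.log_le_sub_one_of_pos (x := Real.exp (u j) / S / p j) (by positivity)
      rw [Real.log_div (by positivity) h.ne', Real.log_div (by positivity) hSpos.ne',
        Real.log_exp] at h1
      have h2 := mul_le_mul_of_nonneg_left h1 h.le
      have h3 : p j * (Real.exp (u j) / S / p j - 1) = Real.exp (u j) / S - p j := by
        field_simp
      linarith
  have h := Finset.sum_le_sum (fun j (_ : j ∈ (univ : Finset (Fin m))) => key j)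
  have e1 : ∑ j, (p j * (u j - Real.log S) - p j * Real.log (p j))
      = (∑ j, u j * p j) - Real.log S - ∑ j, p j * Real.log (p j) := by
    rw [Finset.sum_sub_distrib]
    congr 1
    simp only [mul_sub]
    rw [Finset.sum_sub_distrib, ← Finset.sum_mul, hs, one_mul]
    simp only [mul_comm]
  have e2 : ∑ j, (Real.exp (u j) / S - p j) = 0 := by
    rw [Finset.sum_sub_distrib, ← Finset.sum_div, hs, ← hS, div_self hSpos.ne', sub_self]
  rw [e1, e2] at h
  linarith

theorem gibbs_least {m : ℕ} (p : Fin m → ℝ) (hp : ∀ j, 0 ≤ p j)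
    (hs : ∑ j, p j = 1) (b : ℝ)
    (hb : ∀ u : Fin m → ℝ, (∑ j, u j * p j) - Real.log (∑ j, Real.exp (u j)) ≤ b) :
    ∑ j, p j * Real.log (p j) ≤ b := by
  have hε : ∀ ε : ℝ, 0 < ε → ∑ j, p j * Real.log (p j) ≤ b + m * ε := by
    intro ε he
    have h := hb (fun j => Real.log (p j + ε))
    have e : ∑ j, Real.exp (Real.log (p j + ε)) = 1 + m * ε := by
      rw [Finset.sum_congr rfl (fun j _ => Real.exp_log (by have := hp j; linarith)),
        Finset.sum_add_distrib, hs]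
      simp
    simp only [e] at h
    have hl := Real.log_le_sub_one_of_pos (x := 1 + m * ε) (by positivity)
    have : ∑ j, p j * Real.log (p j) ≤ ∑ j, Real.log (p j + ε) * p j := by
      apply Finset.sum_le_sum
      intro j _
      rcases (hp j).eq_or_lt with h | h
      · simp [← h]
      · rw [mul_comm]
        exact mul_le_mul_of_nonneg_right (Real.log_le_log h (by linarith)) h.le
    linarith
  refine le_of_forall_pos_le_add fun δ hδ => ?_
  have h := hε (δ / (m + 1)) (by positivity)
  have : (m : ℝ) * (δ / (m + 1)) ≤ δ := by
    rw [← mul_div_assoc, div_le_iff₀ (by positivity)]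
    nlinarith
  linarith

theorem gibbs_bdd {m : ℕ} (hm : 0 < m) (p : Fin m → ℝ) (b : ℝ)
    (hb : ∀ u : Fin m → ℝ, (∑ j, u j * p j) - Real.log (∑ j, Real.exp (u j)) ≤ b) :
    (∀ j, 0 ≤ p j) ∧ ∑ j, p j = 1 := by
  have : Nonempty (Fin m) := ⟨⟨0, hm⟩⟩
  have hm' : (0 : ℝ) < m := by exact_mod_cast hm
  constructor
  · intro k
    by_contra! hk
    have hb0 : ∀ t : ℝ, 0 ≤ t → -t * p k - Real.log m ≤ b := by
      intro t ht
      have h := hb (fun j => if j = k then -t else 0)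
      have h1 : ∑ j, Real.exp (if j = k then -t else 0) ≤ m := by
        calc _ ≤ ∑ j : Fin m, (1 : ℝ) := by
              apply Finset.sum_le_sum
              intro j _
              rw [Real.exp_le_one_iff]
              split_ifs <;> linarith
          _ = m := by simp
      have h2 := Real.log_le_log (Finset.sum_pos (fun j _ => Real.exp_pos _) univ_nonempty) h1
      simp only [ite_mul, zero_mul, Finset.sum_ite_eq', Finset.mem_univ, if_true] at h
      linarith
    have h := hb0 ((|b + Real.log m| + 1) / (-p k))
      (div_nonneg (by positivity) (by linarith))
    have e : -((|b + Real.log m| + 1) / (-p k)) * p k = |b + Real.log m| + 1 := by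
      have hk0 : p k ≠ 0 := hk.ne
      field_simp
    rw [e] at h
    have := le_abs_self (b + Real.log m)
    linarith
  · by_contra hs
    have hs' : (∑ j, p j) - 1 ≠ 0 := sub_ne_zero.mpr hs
    have h := hb (fun _ => (b + Real.log m + 1) / ((∑ j, p j) - 1))
    set t := (b + Real.log m + 1) / ((∑ j, p j) - 1) with ht
    have e : t * ((∑ j, p j) - 1) = b + Real.log m + 1 := by
      rw [ht]; field_simp
    rw [← Finset.mul_sum, Finset.sum_const, Finset.card_univ, Fintype.card_fin, nsmul_eq_mul,
      Real.log_mul hm'.ne' (Real.exp_pos _).ne', Real.log_exp] at h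
    linarith

theorem stmt_10 (m : ℕ) (hm : 2 ≤ m) (y : Fin m) (v : Fin m → ℝ) :
    ((∑ j, v j = 0 ∧ (∀ j, j ≠ y → 0 ≤ v j) ∧
        ∑ j ∈ univ.filter (· ≠ y), v j ≤ 1) →
      IsLUB {r : ℝ | ∃ u : Fin m → ℝ,
          r = (∑ j, u j * v j) - Real.log (∑ j, Real.exp (u j - u y))}
        ((∑ j ∈ univ.filter (· ≠ y), v j * Real.log (v j)) +
          (1 + v y) * Real.log (1 + v y))) ∧
    (¬ (∑ j, v j = 0 ∧ (∀ j, j ≠ y → 0 ≤ v j) ∧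
        ∑ j ∈ univ.filter (· ≠ y), v j ≤ 1) →
      ¬ BddAbove {r : ℝ | ∃ u : Fin m → ℝ,
          r = (∑ j, u j * v j) - Real.log (∑ j, Real.exp (u j - u y))}) := by
  have hm0 : 0 < m := by omega
  have : Nonempty (Fin m) := ⟨y⟩
  obtain ⟨p, hpdef⟩ : ∃ p : Fin m → ℝ, p = fun j => v j + if j = y then 1 else 0 := ⟨_, rfl⟩
  have hpy : p y = 1 + v y := by simp [hpdef, add_comm]
  have hpj : ∀ j, j ≠ y → p j = v j := fun j hj => by simp [hpdef, hj]
  have hsum : ∑ j, p j = ∑ j, v j + 1 := by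
    simp [hpdef, Finset.sum_add_distrib]
  have hsplit : ∀ f : Fin m → ℝ, ∑ j ∈ univ.filter (· ≠ y), f j + f y = ∑ j, f j := by
    intro f
    rw [Finset.filter_ne']
    exact Finset.sum_erase_add _ _ (Finset.mem_univ y)
  have hF : ∀ u : Fin m → ℝ, (∑ j, u j * v j) - Real.log (∑ j, Real.exp (u j - u y))
      = (∑ j, u j * p j) - Real.log (∑ j, Real.exp (u j)) := by
    intro u
    have h1 : ∑ j, u j * p j = ∑ j, u j * v j + u y := by
      simp [hpdef, mul_add, Finset.sum_add_distrib]
    have h2 : ∑ j, Real.exp (u j - u y) = (∑ j, Real.exp (u j)) / Real.exp (u y) := by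
      simp only [Real.exp_sub, Finset.sum_div]
    have h3 : 0 < ∑ j, Real.exp (u j) :=
      Finset.sum_pos (fun j _ => Real.exp_pos _) univ_nonempty
    rw [h1, h2, Real.log_div h3.ne' (Real.exp_pos _).ne', Real.log_exp]
    ring
  have hv := hsplit v
  have hval : (∑ j ∈ univ.filter (· ≠ y), v j * Real.log (v j)) +
      (1 + v y) * Real.log (1 + v y) = ∑ j, p j * Real.log (p j) := by
    rw [← hsplit (fun j => p j * Real.log (p j)), hpy]
    congr 1
    apply Finset.sum_congr rfl
    intro j hj
    rw [hpj j (Finset.mem_filter.mp hj).2]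
  constructor
  · rintro ⟨h0, h1, h2⟩
    have hp : ∀ j, 0 ≤ p j := by
      intro j
      by_cases hj : j = y
      · rw [hj, hpy]; linarith
      · rw [hpj j hj]; exact h1 j hj
    have hs : ∑ j, p j = 1 := by rw [hsum, h0, zero_add]
    rw [hval]
    constructor
    · rintro r ⟨u, rfl⟩
      rw [hF]
      exact gibbs_upper hm0 p u hp hs
    · intro b hb
      exact gibbs_least p hp hs b fun u => hF u ▸ hb ⟨u, rfl⟩
  · rintro hn ⟨b, hb⟩
    apply hn
    obtain ⟨hp, hs⟩ := gibbs_bdd hm0 p b fun u => hF u ▸ hb ⟨u, rfl⟩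
    have h0 : ∑ j, v j = 0 := by linarith
    refine ⟨h0, fun j hj => hpj j hj ▸ hp j, ?_⟩
    have := hp y
    rw [hpy] at this
    linarith
end

section
/- Fix m ≥ 2 and a nonempty proper subset Y ⊊ {1,…,m}, with complement Ȳ = {1,…,m} \ Y. Define the multilabel SVM loss L : ℝ^m → ℝ by L(u) = max{ 0, 1 + max_{j ∈ Ȳ} u_j − min_{y ∈ Y} u_y }. Then for every v ∈ ℝ^m: sup_{u ∈ ℝ^m} { ⟨u, v⟩ − L(u) } = −Σ_{j ∈ Ȳ} v_j if v ∈ S_Y, and +∞ otherwise, where S_Y = { v ∈ ℝ^m : −Σ_{y ∈ Y} v_y = Σ_{j ∈ Ȳ} v_j ≤ 1, v_y ≤ 0 for all y ∈ Y, and v_j ≥ 0 for all j ∈ Ȳ }. -/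
open Finset

theorem stmt_12 (m : ℕ) (hm : 2 ≤ m) (Y : Finset (Fin m))
    (hY1 : Y.Nonempty) (hY2 : Y ≠ Finset.univ) (v : Fin m → ℝ) :
    ((-∑ y ∈ Y, v y = ∑ j ∈ Yᶜ, v j ∧ ∑ j ∈ Yᶜ, v j ≤ 1 ∧
        (∀ y ∈ Y, v y ≤ 0) ∧ ∀ j ∈ Yᶜ, 0 ≤ v j) →
      IsLUB {r : ℝ | ∃ u : Fin m → ℝ, r = (∑ j, u j * v j) -
          max 0 (1 + Yᶜ.sup' (Finset.nonempty_iff_ne_empty.mpr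
              (fun h => hY2 ((Finset.compl_eq_empty_iff Y).mp h))) u -
            Y.inf' hY1 u)}
        (-∑ j ∈ Yᶜ, v j)) ∧
    (¬ (-∑ y ∈ Y, v y = ∑ j ∈ Yᶜ, v j ∧ ∑ j ∈ Yᶜ, v j ≤ 1 ∧
        (∀ y ∈ Y, v y ≤ 0) ∧ ∀ j ∈ Yᶜ, 0 ≤ v j) →
      ¬ BddAbove {r : ℝ | ∃ u : Fin m → ℝ, r = (∑ j, u j * v j) -
          max 0 (1 + Yᶜ.sup' (Finset.nonempty_iff_ne_empty.mpr
              (fun h => hY2 ((Finset.compl_eq_empty_iff Y).mp h))) u -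
            Y.inf' hY1 u)}) := by
  generalize_proofs hC
  have split : ∀ f : Fin m → ℝ, ∑ j, f j = ∑ j ∈ Y, f j + ∑ j ∈ Yᶜ, f j :=
    fun f => (Finset.sum_add_sum_compl Y f).symm
  constructor
  · rintro ⟨h1, h2, h3, h4⟩
    constructor
    · rintro r ⟨u, rfl⟩
      have e1 : ∑ j ∈ Y, u j * v j ≤ (Y.inf' hY1 u) * ∑ j ∈ Y, v j := by
        rw [Finset.mul_sum]
        exact Finset.sum_le_sum fun j hj =>
          mul_le_mul_of_nonpos_right (Finset.inf'_le u hj) (h3 j hj)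
      have e2 : ∑ j ∈ Yᶜ, u j * v j ≤ (Yᶜ.sup' hC u) * ∑ j ∈ Yᶜ, v j := by
        rw [Finset.mul_sum]
        exact Finset.sum_le_sum fun j hj =>
          mul_le_mul_of_nonneg_right (Finset.le_sup' u hj) (h4 j hj)
      have e0 : 0 ≤ ∑ j ∈ Yᶜ, v j := Finset.sum_nonneg h4
      have e3 : ∑ j ∈ Y, v j = -∑ j ∈ Yᶜ, v j := by linarith
      rw [split]
      rw [e3] at e1
      generalize Y.inf' hY1 u = b at *
      generalize Yᶜ.sup' hC u = a at *
      generalize ∑ j ∈ Yᶜ, v j = s at *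
      have k1 := le_max_left 0 (1 + a - b)
      have k2 := le_max_right 0 (1 + a - b)
      generalize max 0 (1 + a - b) = M at *
      have k3 : s * (1 + a - b) ≤ s * M := mul_le_mul_of_nonneg_left k2 e0
      have k4 : s * M ≤ 1 * M := mul_le_mul_of_nonneg_right h2 k1
      linarith
    · intro B hB
      apply hB
      refine ⟨fun j => if j ∈ Y then 1 else 0, ?_⟩
      have s1 : Yᶜ.sup' hC (fun j => if j ∈ Y then (1:ℝ) else 0) = 0 := by
        rw [Finset.sup'_congr hC rfl (g := fun _ => (0:ℝ))]
        · simp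
        · intro x hx
          simp [Finset.mem_compl.mp hx]
      have s2 : Y.inf' hY1 (fun j => if j ∈ Y then (1:ℝ) else 0) = 1 := by
        rw [Finset.inf'_congr hY1 rfl (g := fun _ => (1:ℝ))]
        · simp
        · intro x hx
          simp [hx]
      rw [s1, s2]
      simp
      linarith
  · rintro hn ⟨B, hB⟩
    apply hn
    have H : ∀ (u : Fin m → ℝ) (a b : ℝ), (∀ j ∈ Yᶜ, u j ≤ a) → (∀ j ∈ Y, b ≤ u j) →
        0 ≤ 1 + a - b → ∑ j, u j * v j - (1 + a - b) ≤ B := by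
      intro u a b ha hb h0
      have h := hB ⟨u, rfl⟩
      have k1 : Yᶜ.sup' hC u ≤ a := Finset.sup'_le hC u ha
      have k2 : b ≤ Y.inf' hY1 u := Finset.le_inf' hY1 u hb
      have k3 : max 0 (1 + Yᶜ.sup' hC u - Y.inf' hY1 u) ≤ 1 + a - b :=
        max_le h0 (by linarith)
      linarith
    have hBa := le_abs_self B
    have hBn := abs_nonneg B
    refine ⟨?_, ?_, ?_, ?_⟩
    · by_contra hne
      have hs : ∑ j, v j ≠ 0 := by
        rw [split]
        intro h
        apply hne
        linarith
      have h := H (fun _ => (B + 2) / ∑ j, v j) ((B + 2) / ∑ j, v j) ((B + 2) / ∑ j, v j)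
        (fun _ _ => le_rfl) (fun _ _ => le_rfl) (by linarith)
      rw [← Finset.mul_sum, div_mul_cancel₀ _ hs] at h
      linarith
    · by_contra! hlt
      have hp : 0 < ∑ j ∈ Yᶜ, v j - 1 := by linarith
      obtain ⟨t, ht⟩ : ∃ t, t = (|B| + 2) / (∑ j ∈ Yᶜ, v j - 1) := ⟨_, rfl⟩
      have ht0 : 0 ≤ t := by rw [ht]; positivity
      have ht1 : t * (∑ j ∈ Yᶜ, v j - 1) = |B| + 2 := by
        rw [ht, div_mul_cancel₀ _ hp.ne']
      have h := H (fun j => if j ∈ Y then 0 else t) t 0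
        (fun j hj => by simp [Finset.mem_compl.mp hj])
        (fun j hj => by simp [hj]) (by linarith)
      have e : ∑ j, (if j ∈ Y then 0 else t) * v j = t * ∑ j ∈ Yᶜ, v j := by
        rw [split, Finset.mul_sum, Finset.sum_eq_zero, zero_add]
        · exact Finset.sum_congr rfl fun j hj => by simp [Finset.mem_compl.mp hj]
        · intro j hj
          simp [hj]
      rw [e] at h
      linarith
    · intro y hy
      by_contra! hlt
      have ht0 : 0 ≤ (|B| + 2) / v y := by positivity
      have h := H (fun j => if j = y then (|B| + 2) / v y else 0) 0 0
        (fun j hj => by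
          have : j ≠ y := fun e => Finset.mem_compl.mp hj (e ▸ hy)
          simp [this])
        (fun j hj => by split_ifs <;> linarith) (by linarith)
      simp only [ite_mul, zero_mul, Finset.sum_ite_eq', Finset.mem_univ, if_true] at h
      rw [div_mul_cancel₀ _ hlt.ne'] at h
      linarith
    · intro y hy
      by_contra! hlt
      have ht0 : (|B| + 2) / v y ≤ 0 :=
        div_nonpos_of_nonneg_of_nonpos (by linarith) hlt.le
      have h := H (fun j => if j = y then (|B| + 2) / v y else 0) 0 0
        (fun j hj => by split_ifs <;> linarith)
        (fun j hj => by
          have : j ≠ y := fun e => Finset.mem_compl.mp hy (e ▸ hj)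
          simp [this]) (by linarith)
      simp only [ite_mul, zero_mul, Finset.sum_ite_eq', Finset.mem_univ, if_true] at h
      rw [div_mul_cancel₀ _ hlt.ne] at h
      linarith
end

section
/- Fix m ≥ 2, a nonempty proper subset Y ⊊ {1,…,m} with complement Ȳ, and γ > 0. Define the smoothed conjugate L*_γ : ℝ^m → ℝ ∪ {+∞} by L*_γ(v) = (1/2)( Σ_{y ∈ Y} v_y − Σ_{j ∈ Ȳ} v_j ) + (γ/2)‖v‖² if v ∈ S_Y, and +∞ otherwise. Then for every u ∈ ℝ^m, the smooth multilabel SVM loss L_γ(u) := sup_{v ∈ ℝ^m} { ⟨u, v⟩ − L*_γ(v) } equals (1/γ)( ⟨b, p⟩ − (1/2)‖p‖² + ⟨b̄, p̄⟩ − (1/2)‖p̄‖² ), where b = (1/2 − u_y)_{y ∈ Y} ∈ ℝ^{|Y|}, b̄ = (1/2 + u_j)_{j ∈ Ȳ} ∈ ℝ^{|Ȳ|}, and (p, p̄) is the Euclidean projection of (b, b̄) onto the bipartite simplex B(γ). Moreover, L_γ is convex and differentiable with a gradient that is Lipschitz continuous with constant 1/γ. -/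
open Finset

/-- The smooth multilabel SVM loss `L_γ(u) = sup_v { ⟨u,v⟩ − L*_γ(v) }`, where
`L*_γ(v) = ½(∑_{y∈Y} v_y − ∑_{j∈Ȳ} v_j) + (γ/2)‖v‖²` on `S_Y` and `+∞` elsewhere. -/
noncomputable def smlLoss {m : ℕ} (Y : Finset (Fin m)) (γ : ℝ)
    (u : EuclideanSpace ℝ (Fin m)) : ℝ :=
  sSup {r : ℝ | ∃ v : Fin m → ℝ,
    (-∑ y ∈ Y, v y = ∑ j ∈ Yᶜ, v j ∧ ∑ j ∈ Yᶜ, v j ≤ 1 ∧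
      (∀ y ∈ Y, v y ≤ 0) ∧ ∀ j ∈ Yᶜ, 0 ≤ v j) ∧
    r = (∑ j, u j * v j) -
      ((1/2) * (∑ y ∈ Y, v y - ∑ j ∈ Yᶜ, v j) + γ/2 * ∑ j, (v j)^2)}

/-- The feasible set `S_Y` inside Euclidean space. -/
def smlSet {m : ℕ} (Y : Finset (Fin m)) : Set (EuclideanSpace ℝ (Fin m)) :=
  {v | -∑ y ∈ Y, v y = ∑ j ∈ Yᶜ, v j ∧ ∑ j ∈ Yᶜ, v j ≤ 1 ∧
      (∀ y ∈ Y, v y ≤ 0) ∧ ∀ j ∈ Yᶜ, 0 ≤ v j}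

/-- The linear shift. -/
noncomputable def smlShift {m : ℕ} (Y : Finset (Fin m)) : EuclideanSpace ℝ (Fin m) :=
  WithLp.toLp 2 (fun j => if j ∈ Y then -(1/2 : ℝ) else 1/2)

theorem sml_obj {m : ℕ} (Y : Finset (Fin m)) (γ : ℝ) (u v : EuclideanSpace ℝ (Fin m)) :
    (∑ j, u j * v j) -
      ((1/2) * (∑ y ∈ Y, v y - ∑ j ∈ Yᶜ, v j) + γ/2 * ∑ j, (v j)^2)
    = inner ℝ (u + smlShift Y) v - γ/2 * ‖v‖^2 := by
  have h1 : inner ℝ u v = ∑ j, u j * v j := by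
    simp [PiLp.inner_apply, mul_comm]
  have h2 : inner ℝ (smlShift Y) v = -(1/2) * (∑ y ∈ Y, v y - ∑ j ∈ Yᶜ, v j) := by
    have : inner ℝ (smlShift Y) v = ∑ j, smlShift Y j * v j := by
      simp [PiLp.inner_apply, mul_comm]
    rw [this, ← Finset.sum_add_sum_compl Y]
    have e1 : ∑ j ∈ Y, smlShift Y j * v j = ∑ j ∈ Y, -(1/2) * v j :=
      Finset.sum_congr rfl fun j hj => by simp [smlShift, hj]
    have e2 : ∑ j ∈ Yᶜ, smlShift Y j * v j = ∑ j ∈ Yᶜ, (1/2) * v j :=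
      Finset.sum_congr rfl fun j hj => by
        have := Finset.mem_compl.1 hj
        simp [smlShift, this]
    rw [e1, e2, ← Finset.mul_sum, ← Finset.mul_sum]
    ring
  rw [inner_add_left, h1, h2, EuclideanSpace.real_norm_sq_eq]
  ring

theorem smlLoss_eq {m : ℕ} (Y : Finset (Fin m)) (γ : ℝ) (u : EuclideanSpace ℝ (Fin m)) :
    smlLoss Y γ u =
      sSup ((fun v => inner ℝ (u + smlShift Y) v - γ/2 * ‖v‖^2) '' smlSet Y) := by
  unfold smlLoss
  congr 1
  ext r
  constructor
  · rintro ⟨v, hv, rfl⟩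
    exact ⟨WithLp.toLp 2 v, hv, (sml_obj Y γ u (WithLp.toLp 2 v)).symm⟩
  · rintro ⟨v, hv, rfl⟩
    exact ⟨v, hv, (sml_obj Y γ u v).symm⟩

theorem smlSet_convex {m : ℕ} (Y : Finset (Fin m)) : Convex ℝ (smlSet Y) := by
  rintro x ⟨hx1, hx2, hx3, hx4⟩ y ⟨hy1, hy2, hy3, hy4⟩ a b ha hb hab
  have hs : ∀ s : Finset (Fin m), ∑ j ∈ s, (a • x + b • y) j
      = a * ∑ j ∈ s, x j + b * ∑ j ∈ s, y j := by
    intro s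
    simp [Finset.sum_add_distrib, Finset.mul_sum]
  refine ⟨?_, ?_, ?_, ?_⟩
  · rw [hs, hs, ← hx1, ← hy1]; ring
  · rw [hs]; nlinarith
  · intro j hj
    have := hx3 j hj
    have := hy3 j hj
    simp only [PiLp.add_apply, PiLp.smul_apply, smul_eq_mul]
    nlinarith
  · intro j hj
    have := hx4 j hj
    have := hy4 j hj
    simp only [PiLp.add_apply, PiLp.smul_apply, smul_eq_mul]
    positivity

theorem smlSet_closed {m : ℕ} (Y : Finset (Fin m)) : IsClosed (smlSet Y) := by
  have e : smlSet Y = {v : EuclideanSpace ℝ (Fin m) | -∑ y ∈ Y, v y = ∑ j ∈ Yᶜ, v j} ∩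
      ({v | ∑ j ∈ Yᶜ, v j ≤ 1} ∩ ((⋂ y ∈ Y, {v | v y ≤ 0}) ∩ ⋂ j ∈ Yᶜ, {v | 0 ≤ v j})) := by
    ext v
    simp only [smlSet, Set.mem_inter_iff, Set.mem_iInter, Set.mem_ofPred_eq]
  rw [e]
  refine IsClosed.inter (isClosed_eq (by fun_prop) (by fun_prop)) (IsClosed.inter
    (isClosed_le (by fun_prop) (by fun_prop)) (IsClosed.inter ?_ ?_))
  · exact isClosed_biInter fun y _ => isClosed_le (by fun_prop) (by fun_prop)
  · exact isClosed_biInter fun y _ => isClosed_le (by fun_prop) (by fun_prop)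

theorem smlSet_nonempty {m : ℕ} (Y : Finset (Fin m)) : (smlSet Y).Nonempty :=
  ⟨0, by simp [smlSet]⟩

theorem sml_max {E : Type*} [NormedAddCommGroup E] [InnerProductSpace ℝ E] (γ : ℝ)
    (w V k : E) :
    inner ℝ w k - γ/2 * ‖k‖^2 = inner ℝ w V - γ/2 * ‖V‖^2
      + inner ℝ (w - γ • V) (k - V) - γ/2 * ‖k - V‖^2 := by
  rw [← real_inner_self_eq_norm_sq, ← real_inner_self_eq_norm_sq, ← real_inner_self_eq_norm_sq]
  simp only [inner_sub_left, inner_sub_right, real_inner_smul_left]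
  rw [real_inner_comm V k]
  ring

theorem sml_exists {m : ℕ} (Y : Finset (Fin m)) (γ : ℝ) (hγ : 0 < γ) :
    ∃ V : EuclideanSpace ℝ (Fin m) → EuclideanSpace ℝ (Fin m),
      ∀ u, V u ∈ smlSet Y ∧
        ∀ k ∈ smlSet Y, inner ℝ (u + smlShift Y - γ • V u) (k - V u) ≤ 0 := by
  have key : ∀ u : EuclideanSpace ℝ (Fin m), ∃ v, v ∈ smlSet Y ∧
        ∀ k ∈ smlSet Y, inner ℝ (u + smlShift Y - γ • v) (k - v) ≤ 0 := by
    intro u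
    obtain ⟨v, hv, h⟩ := exists_norm_eq_iInf_of_complete_convex (smlSet_nonempty Y)
      (smlSet_closed Y).isComplete (smlSet_convex Y) (γ⁻¹ • (u + smlShift Y))
    rw [norm_eq_iInf_iff_real_inner_le_zero (smlSet_convex Y) hv] at h
    refine ⟨v, hv, fun k hk => ?_⟩
    have h1 := h k hk
    have e : u + smlShift Y - γ • v = γ • (γ⁻¹ • (u + smlShift Y) - v) := by
      rw [smul_sub, smul_inv_smul₀ hγ.ne']
    rw [e, real_inner_smul_left]
    nlinarith
  choose V hV using key
  exact ⟨V, hV⟩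

theorem sml_part1 {m : ℕ} (Y : Finset (Fin m)) (γ : ℝ) (hγ : 0 < γ)
    (u : EuclideanSpace ℝ (Fin m)) (p pb : Fin m → ℝ)
    (hp : (∑ y ∈ Y, p y = ∑ j ∈ Yᶜ, pb j) ∧ (∑ j ∈ Yᶜ, pb j ≤ γ) ∧
        (∀ y ∈ Y, 0 ≤ p y) ∧ (∀ j ∈ Yᶜ, 0 ≤ pb j))
    (hmin : ∀ x z : Fin m → ℝ,
        ((∑ y ∈ Y, x y = ∑ j ∈ Yᶜ, z j) ∧ (∑ j ∈ Yᶜ, z j ≤ γ) ∧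
          (∀ y ∈ Y, 0 ≤ x y) ∧ (∀ j ∈ Yᶜ, 0 ≤ z j)) →
        ∑ y ∈ Y, (p y - (1/2 - u y))^2 + ∑ j ∈ Yᶜ, (pb j - (1/2 + u j))^2 ≤
          ∑ y ∈ Y, (x y - (1/2 - u y))^2 + ∑ j ∈ Yᶜ, (z j - (1/2 + u j))^2) :
    smlLoss Y γ u = (1/γ) *
        (∑ y ∈ Y, (1/2 - u y) * p y - (1/2) * ∑ y ∈ Y, (p y)^2 +
          ∑ j ∈ Yᶜ, (1/2 + u j) * pb j - (1/2) * ∑ j ∈ Yᶜ, (pb j)^2) := by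
  -- the objective in terms of scaled variables
  have obj : ∀ v x z : Fin m → ℝ, (∀ y ∈ Y, v y = -(x y) / γ) → (∀ j ∈ Yᶜ, v j = z j / γ) →
      (∑ j, u j * v j) -
      ((1/2) * (∑ y ∈ Y, v y - ∑ j ∈ Yᶜ, v j) + γ/2 * ∑ j, (v j)^2) =
      (1/γ) * (∑ y ∈ Y, (1/2 - u y) * x y - (1/2) * ∑ y ∈ Y, (x y)^2 +
          ∑ j ∈ Yᶜ, (1/2 + u j) * z j - (1/2) * ∑ j ∈ Yᶜ, (z j)^2) := by
    intro v x z h1 h2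
    rw [← Finset.sum_add_sum_compl Y (fun j => u j * v j),
      ← Finset.sum_add_sum_compl Y (fun j => (v j)^2)]
    have a1 : (∑ j ∈ Y, u j * v j) - 1/2 * ∑ y ∈ Y, v y - γ/2 * ∑ j ∈ Y, (v j)^2
        = (1/γ) * (∑ y ∈ Y, (1/2 - u y) * x y - (1/2) * ∑ y ∈ Y, (x y)^2) := by
      simp only [Finset.mul_sum, ← Finset.sum_sub_distrib]
      refine Finset.sum_congr rfl fun j hj => ?_
      rw [h1 j hj]
      field_simp
      ring
    have a2 : (∑ j ∈ Yᶜ, u j * v j) + 1/2 * ∑ y ∈ Yᶜ, v y - γ/2 * ∑ j ∈ Yᶜ, (v j)^2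
        = (1/γ) * (∑ y ∈ Yᶜ, (1/2 + u y) * z y - (1/2) * ∑ y ∈ Yᶜ, (z y)^2) := by
      simp only [Finset.mul_sum, ← Finset.sum_sub_distrib, ← Finset.sum_add_distrib]
      refine Finset.sum_congr rfl fun j hj => ?_
      rw [h2 j hj]
      field_simp
      ring
    linear_combination a1 + a2
  have dist : ∀ x z : Fin m → ℝ,
      ∑ y ∈ Y, (x y - (1/2 - u y))^2 + ∑ j ∈ Yᶜ, (z j - (1/2 + u j))^2 =
      -2 * (∑ y ∈ Y, (1/2 - u y) * x y - (1/2) * ∑ y ∈ Y, (x y)^2 +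
          ∑ j ∈ Yᶜ, (1/2 + u j) * z j - (1/2) * ∑ j ∈ Yᶜ, (z j)^2)
      + (∑ y ∈ Y, (1/2 - u y)^2 + ∑ y ∈ Yᶜ, (1/2 + u y)^2) := by
    intro x z
    have a1 : ∑ y ∈ Y, (x y - (1/2 - u y))^2 = -2 * (∑ y ∈ Y, (1/2 - u y) * x y)
        + ∑ y ∈ Y, (x y)^2 + ∑ y ∈ Y, (1/2 - u y)^2 := by
      simp only [Finset.mul_sum, ← Finset.sum_add_distrib]
      exact Finset.sum_congr rfl fun j hj => by ring
    have a2 : ∑ y ∈ Yᶜ, (z y - (1/2 + u y))^2 = -2 * (∑ y ∈ Yᶜ, (1/2 + u y) * z y)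
        + ∑ y ∈ Yᶜ, (z y)^2 + ∑ y ∈ Yᶜ, (1/2 + u y)^2 := by
      simp only [Finset.mul_sum, ← Finset.sum_add_distrib]
      exact Finset.sum_congr rfl fun j hj => by ring
    linear_combination a1 + a2
  obtain ⟨p1, p2, p3, p4⟩ := hp
  unfold smlLoss
  refine IsGreatest.csSup_eq ⟨?_, ?_⟩
  · have c1 : ∀ y ∈ Y, (fun j => if j ∈ Y then -(p j) / γ else pb j / γ) y = -(p y) / γ :=
      fun y hy => by simp [hy]
    have c2 : ∀ y ∈ Yᶜ, (fun j => if j ∈ Y then -(p j) / γ else pb j / γ) y = pb y / γ :=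
      fun y hy => by
        have := Finset.mem_compl.1 hy
        simp [this]
    refine ⟨fun j => if j ∈ Y then -(p j) / γ else pb j / γ, ⟨?_, ?_, ?_, ?_⟩,
      (obj _ p pb c1 c2).symm⟩
    · rw [Finset.sum_congr rfl c1, Finset.sum_congr rfl c2, ← Finset.sum_div, ← Finset.sum_div,
        ← p1, Finset.sum_neg_distrib]
      ring
    · rw [Finset.sum_congr rfl c2, ← Finset.sum_div]
      exact (div_le_one hγ).2 p2
    · intro y hy
      rw [c1 y hy]
      exact div_nonpos_of_nonpos_of_nonneg (neg_nonpos.2 (p3 y hy)) hγ.le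
    · intro y hy
      rw [c2 y hy]
      exact div_nonneg (p4 y hy) hγ.le
  · rintro r ⟨v, ⟨v1, v2, v3, v4⟩, rfl⟩
    rw [obj v (fun j => -γ * v j) (fun j => γ * v j) (fun y _ => by field_simp)
      (fun y _ => by field_simp)]
    have h := hmin (fun j => -γ * v j) (fun j => γ * v j) ⟨?_, ?_, ?_, ?_⟩
    · rw [dist, dist] at h
      refine mul_le_mul_of_nonneg_left ?_ (by positivity)
      linarith
    · rw [← Finset.mul_sum, ← Finset.mul_sum, ← v1]; ring
    · rw [← Finset.mul_sum]; nlinarith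
    · intro y hy
      have := v3 y hy
      nlinarith
    · intro y hy
      exact mul_nonneg hγ.le (v4 y hy)

theorem sml_part2 {m : ℕ} (Y : Finset (Fin m)) (γ : ℝ) (hγ : 0 < γ) :
    ConvexOn ℝ Set.univ (smlLoss Y γ) ∧
    ∃ G : EuclideanSpace ℝ (Fin m) → EuclideanSpace ℝ (Fin m),
      (∀ u, HasGradientAt (smlLoss Y γ) (G u) u) ∧
      LipschitzWith (1/γ).toNNReal G := by
  obtain ⟨V, hV⟩ := sml_exists Y γ hγ
  have hle : ∀ u, ∀ k ∈ smlSet Y, inner ℝ (u + smlShift Y) k - γ/2 * ‖k‖^2 ≤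
      inner ℝ (u + smlShift Y) (V u) - γ/2 * ‖V u‖^2 := by
    intro u k hk
    rw [sml_max γ (u + smlShift Y) (V u) k]
    have := (hV u).2 k hk
    have : 0 ≤ γ/2 * ‖k - V u‖^2 := by positivity
    linarith
  have hf : ∀ u, smlLoss Y γ u = inner ℝ (u + smlShift Y) (V u) - γ/2 * ‖V u‖^2 := by
    intro u
    rw [smlLoss_eq]
    refine IsGreatest.csSup_eq ⟨⟨V u, (hV u).1, rfl⟩, ?_⟩
    rintro _ ⟨k, hk, rfl⟩
    exact hle u k hk
  have sub : ∀ u u', smlLoss Y γ u + inner ℝ (u' - u) (V u) ≤ smlLoss Y γ u' := by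
    intro u u'
    have h := hle u' (V u) (hV u).1
    rw [← hf u'] at h
    rw [hf u]
    simp only [inner_add_left, inner_sub_left] at h ⊢
    linarith
  have lip : ∀ u u', ‖V u - V u'‖ ≤ (1/γ) * ‖u - u'‖ := by
    intro u u'
    have h1 := (hV u).2 (V u') (hV u').1
    have h2 := (hV u').2 (V u) (hV u).1
    have h3 : γ * ‖V u - V u'‖^2 ≤ inner ℝ (u - u') (V u - V u') := by
      rw [← real_inner_self_eq_norm_sq]
      simp only [inner_sub_left, inner_sub_right, inner_add_left, real_inner_smul_left] at h1 h2 ⊢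
      linarith
    have h4 := real_inner_le_norm (u - u') (V u - V u')
    rw [one_div, inv_mul_eq_div, le_div_iff₀ hγ]
    rcases (norm_nonneg (V u - V u')).eq_or_lt with h0 | h0
    · rw [← h0]; simp
    · refine le_of_mul_le_mul_right ?_ h0
      nlinarith
  refine ⟨⟨convex_univ, ?_⟩, V, ?_, ?_⟩
  · intro x _ y _ a b ha hb hab
    have h1 := mul_le_mul_of_nonneg_left (sub (a • x + b • y) x) ha
    have h2 := mul_le_mul_of_nonneg_left (sub (a • x + b • y) y) hb
    generalize V (a • x + b • y) = W at h1 h2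
    generalize hF : smlLoss Y γ (a • x + b • y) = F at h1 h2 ⊢
    simp only [inner_add_left, inner_sub_left, real_inner_smul_left, smul_eq_mul] at h1 h2 ⊢
    have hb' : b = 1 - a := by linarith
    subst hb'
    nlinarith
  · intro u
    rw [hasGradientAt_iff_isLittleO]
    have hO : (fun x' => smlLoss Y γ x' - smlLoss Y γ u - inner ℝ (V u) (x' - u))
        =O[nhds u] fun x' => ‖x' - u‖^2 := by
      refine Asymptotics.IsBigO.of_bound (1/γ) (Filter.Eventually.of_forall fun x => ?_)
      have h1 := sub u x
      have h2 := sub x u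
      have h3 := real_inner_le_norm (x - u) (V x - V u)
      have h4 := mul_le_mul_of_nonneg_left (lip x u) (norm_nonneg (x - u))
      rw [real_inner_comm, Real.norm_eq_abs, Real.norm_eq_abs, abs_of_nonneg (sq_nonneg ‖x - u‖),
        abs_of_nonneg (by linarith)]
      have h5 : inner ℝ (x - u) (V x) = - inner ℝ (u - x) (V x) := by
        rw [← inner_neg_left, neg_sub]
      rw [inner_sub_right, h5] at h3
      nlinarith
    refine hO.trans_isLittleO ?_
    exact Asymptotics.isLittleO_pow_sub_sub u (by norm_num)
  · refine LipschitzWith.of_dist_le_mul fun x y => ?_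
    rw [dist_eq_norm, dist_eq_norm, Real.coe_toNNReal _ (by positivity)]
    exact lip x y

theorem stmt_13 (m : ℕ) (hm : 2 ≤ m) (Y : Finset (Fin m))
    (hY1 : Y.Nonempty) (hY2 : Y ≠ Finset.univ) (γ : ℝ) (hγ : 0 < γ) :
    (∀ u : EuclideanSpace ℝ (Fin m), ∀ p pb : Fin m → ℝ,
      -- (p, pb) belongs to the bipartite simplex B(γ)
      ((∑ y ∈ Y, p y = ∑ j ∈ Yᶜ, pb j) ∧ (∑ j ∈ Yᶜ, pb j ≤ γ) ∧
        (∀ y ∈ Y, 0 ≤ p y) ∧ (∀ j ∈ Yᶜ, 0 ≤ pb j)) →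
      -- and (p, pb) is the Euclidean projection of (b, b̄) onto B(γ)
      (∀ x z : Fin m → ℝ,
        ((∑ y ∈ Y, x y = ∑ j ∈ Yᶜ, z j) ∧ (∑ j ∈ Yᶜ, z j ≤ γ) ∧
          (∀ y ∈ Y, 0 ≤ x y) ∧ (∀ j ∈ Yᶜ, 0 ≤ z j)) →
        ∑ y ∈ Y, (p y - (1/2 - u y))^2 + ∑ j ∈ Yᶜ, (pb j - (1/2 + u j))^2 ≤
          ∑ y ∈ Y, (x y - (1/2 - u y))^2 + ∑ j ∈ Yᶜ, (z j - (1/2 + u j))^2) →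
      smlLoss Y γ u = (1/γ) *
        (∑ y ∈ Y, (1/2 - u y) * p y - (1/2) * ∑ y ∈ Y, (p y)^2 +
          ∑ j ∈ Yᶜ, (1/2 + u j) * pb j - (1/2) * ∑ j ∈ Yᶜ, (pb j)^2)) ∧
    ConvexOn ℝ Set.univ (smlLoss Y γ) ∧
    ∃ G : EuclideanSpace ℝ (Fin m) → EuclideanSpace ℝ (Fin m),
      (∀ u, HasGradientAt (smlLoss Y γ) (G u) u) ∧
      LipschitzWith (1/γ).toNNReal G := by
  exact ⟨fun u p pb hp hmin => sml_part1 Y γ hγ u p pb hp hmin, sml_part2 Y γ hγ⟩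
end

section
/- Fix m ≥ 2 and a nonempty proper subset Y ⊊ {1,…,m} with complement Ȳ, and let k = |Y|. Define the multilabel cross-entropy loss L : ℝ^m → ℝ by L(u) = (1/k) Σ_{y ∈ Y} log( Σ_{j=1}^m exp(u_j − u_y) ). Then for every v ∈ ℝ^m: sup_{u ∈ ℝ^m} { ⟨u, v⟩ − L(u) } = Σ_{y ∈ Y} (v_y + 1/k) log(v_y + 1/k) + Σ_{j ∈ Ȳ} v_j log v_j if v ∈ D_Y (with 0·log 0 = 0), and +∞ otherwise, where D_Y = { v ∈ ℝ^m : Σ_{y ∈ Y} (v_y + 1/k) + Σ_{j ∈ Ȳ} v_j = 1, v_y + 1/k ≥ 0 for all y ∈ Y, v_j ≥ 0 for all j ∈ Ȳ }. -/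
open Finset

lemma aux_obj (m : ℕ) (Y : Finset (Fin m)) (hY1 : Y.Nonempty) (v u : Fin m → ℝ) :
    (∑ j, u j * v j) - (1/(Y.card : ℝ)) * ∑ y ∈ Y, Real.log (∑ j, Real.exp (u j - u y)) =
    (∑ j, u j * (v j + if j ∈ Y then 1/(Y.card : ℝ) else 0)) -
      Real.log (∑ j, Real.exp (u j)) := by
  have hk : (Y.card : ℝ) ≠ 0 := by
    have := hY1.card_pos
    positivity
  obtain ⟨y0, hy0⟩ := hY1
  have hpos : 0 < ∑ j, Real.exp (u j) :=
    Finset.sum_pos (fun j _ => Real.exp_pos _) ⟨y0, Finset.mem_univ _⟩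
  have h1 : ∀ y ∈ Y, Real.log (∑ j, Real.exp (u j - u y)) =
      Real.log (∑ j, Real.exp (u j)) - u y := by
    intro y _
    simp_rw [Real.exp_sub]
    rw [← Finset.sum_div, Real.log_div hpos.ne' (Real.exp_pos _).ne', Real.log_exp]
  rw [Finset.sum_congr rfl h1, Finset.sum_sub_distrib, Finset.sum_const, nsmul_eq_mul]
  simp_rw [mul_add]
  rw [Finset.sum_add_distrib]
  have h2 : ∑ j, u j * (if j ∈ Y then 1/(Y.card : ℝ) else 0) = (1/(Y.card : ℝ)) * ∑ y ∈ Y, u y := by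
    simp [Finset.sum_ite_mem, Finset.sum_mul, mul_comm]
  rw [h2]
  field_simp
  ring

lemma aux_gibbs (m : ℕ) (h0 : 0 < m) (w : Fin m → ℝ) (hw : ∀ j, 0 ≤ w j) (hs : ∑ j, w j = 1) :
    IsLUB {r : ℝ | ∃ u : Fin m → ℝ, r = (∑ j, u j * w j) - Real.log (∑ j, Real.exp (u j))}
      (∑ j, w j * Real.log (w j)) := by
  have : Nonempty (Fin m) := ⟨⟨0, h0⟩⟩
  have hm : (0 : ℝ) < m := by exact_mod_cast h0
  constructor
  · rintro r ⟨u, rfl⟩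
    have hpos : 0 < ∑ j, Real.exp (u j) :=
      Finset.sum_pos (fun j _ => Real.exp_pos _) Finset.univ_nonempty
    set S := ∑ j, Real.exp (u j) with hS
    have h : ∀ j ∈ Finset.univ, u j * w j - w j * Real.log S - w j * Real.log (w j) ≤
        Real.exp (u j) / S - w j := by
      intro j _
      rcases (hw j).eq_or_lt with h | h
      · rw [← h]
        simp only [mul_zero, zero_mul, sub_zero]
        positivity
      · have h2 := Real.log_le_sub_one_of_pos (x := Real.exp (u j) / S / w j) (by positivity)
        rw [Real.log_div (by positivity) h.ne', Real.log_div (by positivity) hpos.ne',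
          Real.log_exp] at h2
        have h3 := mul_le_mul_of_nonneg_left h2 h.le
        have h4 : w j * (Real.exp (u j) / S / w j - 1) = Real.exp (u j) / S - w j := by
          field_simp
        linarith
    have h5 := Finset.sum_le_sum h
    simp only [Finset.sum_sub_distrib, ← Finset.sum_mul, ← Finset.sum_div] at h5
    rw [hs, ← hS, div_self hpos.ne'] at h5
    linarith
  · intro b hb
    apply le_of_forall_pos_le_add
    intro e he
    have hd : 0 < e / m := by positivity
    have h1 := hb ⟨fun j => Real.log (w j + e / m), rfl⟩
    have h2 : ∀ j, Real.exp (Real.log (w j + e / m)) = w j + e / m := fun j =>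
      Real.exp_log (by have := hw j; linarith)
    simp only [h2, Finset.sum_add_distrib, hs, Finset.sum_const, Finset.card_univ,
      Fintype.card_fin, nsmul_eq_mul] at h1
    rw [mul_div_cancel₀ _ hm.ne'] at h1
    have h3 := Real.log_le_sub_one_of_pos (x := 1 + e) (by linarith)
    have h4 : ∑ j, w j * Real.log (w j) ≤ ∑ j, Real.log (w j + e / m) * w j := by
      apply Finset.sum_le_sum
      intro j _
      rcases (hw j).eq_or_lt with h | h
      · simp [← h]
      · rw [mul_comm]
        exact mul_le_mul_of_nonneg_right (Real.log_le_log h (by linarith)) h.le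
    linarith

lemma aux_unb (m : ℕ) (h0 : 0 < m) (w : Fin m → ℝ) (h : ¬ (∑ j, w j = 1 ∧ ∀ j, 0 ≤ w j)) :
    ¬ BddAbove {r : ℝ | ∃ u : Fin m → ℝ,
      r = (∑ j, u j * w j) - Real.log (∑ j, Real.exp (u j))} := by
  have : Nonempty (Fin m) := ⟨⟨0, h0⟩⟩
  have hm : (0 : ℝ) < m := by exact_mod_cast h0
  rintro ⟨b, hb⟩
  by_cases hs : ∑ j, w j = 1
  · have : ∃ j, w j < 0 := by
      by_contra! h'
      exact h ⟨hs, h'⟩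
    obtain ⟨i, hi⟩ := this
    have hlm : 0 ≤ Real.log m := Real.log_natCast_nonneg m
    set t := (|b| + Real.log m + 1) / (- w i) with ht
    have ht0 : 0 ≤ t := div_nonneg (by positivity) (by linarith)
    have h1 := hb ⟨fun j => if j = i then -t else 0, rfl⟩
    simp only [ite_mul, zero_mul, Finset.sum_ite_eq', Finset.mem_univ, if_true] at h1
    have h2 : ∑ j : Fin m, Real.exp (if j = i then -t else 0) ≤ m := by
      calc _ ≤ ∑ j : Fin m, (1 : ℝ) := by
            apply Finset.sum_le_sum
            intro j _
            rw [Real.exp_le_one_iff]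
            split_ifs <;> linarith
        _ = m := by simp
    have h3 := Real.log_le_log
      (Finset.sum_pos (fun j _ => Real.exp_pos _) Finset.univ_nonempty) h2
    have h4 : t * (- w i) = |b| + Real.log m + 1 := div_mul_cancel₀ _ (by linarith)
    have := le_abs_self b
    linarith
  · have hs' : ∑ j, w j - 1 ≠ 0 := sub_ne_zero.2 hs
    set t := (b + Real.log m + 1) / (∑ j, w j - 1) with ht
    have h1 := hb ⟨fun j => t, rfl⟩
    simp only [← Finset.mul_sum, Finset.sum_const, Finset.card_univ,
      Fintype.card_fin, nsmul_eq_mul] at h1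
    rw [Real.log_mul hm.ne' (Real.exp_pos _).ne', Real.log_exp] at h1
    have h4 : t * (∑ j, w j - 1) = b + Real.log m + 1 := div_mul_cancel₀ _ hs'
    linarith

lemma aux_split (m : ℕ) (Y : Finset (Fin m)) (v : Fin m → ℝ) (c : ℝ) (f : ℝ → ℝ) :
    ∑ j, f (v j + if j ∈ Y then c else 0) = ∑ y ∈ Y, f (v y + c) + ∑ j ∈ Yᶜ, f (v j) := by
  rw [← Finset.sum_add_sum_compl Y]
  congr 1
  · exact Finset.sum_congr rfl fun j hj => by simp [hj]
  · exact Finset.sum_congr rfl fun j hj => by simp [Finset.mem_compl.1 hj]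

theorem stmt_14 (m : ℕ) (hm : 2 ≤ m) (Y : Finset (Fin m))
    (hY1 : Y.Nonempty) (hY2 : Y ≠ Finset.univ) (v : Fin m → ℝ) :
    (((∑ y ∈ Y, (v y + 1/(Y.card : ℝ))) + (∑ j ∈ Yᶜ, v j) = 1 ∧
        (∀ y ∈ Y, 0 ≤ v y + 1/(Y.card : ℝ)) ∧ ∀ j ∈ Yᶜ, 0 ≤ v j) →
      IsLUB {r : ℝ | ∃ u : Fin m → ℝ, r = (∑ j, u j * v j) -
          (1/(Y.card : ℝ)) * ∑ y ∈ Y, Real.log (∑ j, Real.exp (u j - u y))}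
        (∑ y ∈ Y, (v y + 1/(Y.card : ℝ)) * Real.log (v y + 1/(Y.card : ℝ)) +
          ∑ j ∈ Yᶜ, v j * Real.log (v j))) ∧
    (¬ ((∑ y ∈ Y, (v y + 1/(Y.card : ℝ))) + (∑ j ∈ Yᶜ, v j) = 1 ∧
        (∀ y ∈ Y, 0 ≤ v y + 1/(Y.card : ℝ)) ∧ ∀ j ∈ Yᶜ, 0 ≤ v j) →
      ¬ BddAbove {r : ℝ | ∃ u : Fin m → ℝ, r = (∑ j, u j * v j) -
          (1/(Y.card : ℝ)) * ∑ y ∈ Y, Real.log (∑ j, Real.exp (u j - u y))}) := by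
  simp only [aux_obj m Y hY1 v]
  have e1 := aux_split m Y v (1/(Y.card : ℝ)) (fun x => x)
  have e2 := aux_split m Y v (1/(Y.card : ℝ)) (fun x => x * Real.log x)

  rw [← e1, ← e2]
  have e3 : ((∀ y ∈ Y, 0 ≤ v y + 1/(Y.card : ℝ)) ∧ ∀ j ∈ Yᶜ, 0 ≤ v j) ↔
      ∀ j, 0 ≤ v j + if j ∈ Y then 1/(Y.card : ℝ) else 0 := by
    constructor
    · rintro ⟨h1, h2⟩ j
      by_cases hj : j ∈ Y
      · simpa only [hj, if_true] using h1 j hj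
      · simpa only [hj, if_false, add_zero] using h2 j (Finset.mem_compl.2 hj)
    · intro h
      refine ⟨fun j hj => ?_, fun j hj => ?_⟩
      · simpa only [hj, if_true] using h j
      · simpa only [Finset.mem_compl.1 hj, if_false, add_zero] using h j
  rw [e3]
  exact ⟨fun h => aux_gibbs m (by omega) _ h.2 h.1, fun h => aux_unb m (by omega) _ h⟩
end

section
/- Fix m ≥ 2, 1 ≤ k ≤ m − 1, γ ≥ 0, λ > 0, n ≥ 1, a label y ∈ {1,…,m}, K_ii > 0, and q ∈ ℝ^m. Let L*_γ be the conjugate of the smooth top-k hinge loss (α version): L*_γ(w) = (γ/2)‖w^{\y}‖² − ⟨w^{\y}, 1⟩ if ⟨1, w⟩ = 0 and w^{\y} ∈ Δ^α_k, and +∞ otherwise, where w^{\y} ∈ ℝ^{m−1} removes the y-th coordinate. Consider maximizing over v ∈ ℝ^m the function D_i(v) = −(1/n)·L*_γ(−λ n v) − (λ/2)( K_ii·⟨v, v⟩ + 2⟨q, v⟩ ). Then v maximizes D_i if and only if ⟨1, v⟩ = 0 and −v^{\y} = argmin over x ∈ Δ^α_k(1/(λn)) of ‖x − b‖² + ρ·⟨1,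 x⟩², where b = ( q^{\y} + (1 − q_y)·1 ) / ( K_ii + γ λ n ) and ρ = K_ii / ( K_ii + γ λ n ) (the argmin is unique since K_ii > 0). -/
open Finset

/-- Membership in the top-k simplex `Δ^α_k(r)` of `ℝ^{m-1}` (coordinates indexed by
`j ≠ y`). -/
def inTopkSimplex (k : ℕ) {m : ℕ} (y : Fin m) (r : ℝ)
    (x : {j : Fin m // j ≠ y} → ℝ) : Prop :=
  (∑ j, x j ≤ r) ∧ ∀ j, 0 ≤ x j ∧ x j ≤ (1/(k:ℝ)) * ∑ l, x l

/-- The dual SDCA objective for the smooth top-k hinge loss (α version),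
evaluated at a feasible `v`: `D_i(v) = −(1/n)·L*_γ(−λnv) − (λ/2)(K_ii⟨v,v⟩ + 2⟨q,v⟩)`,
where `L*_γ(w) = (γ/2)‖w^{\y}‖² − ⟨w^{\y}, 1⟩`. -/
noncomputable def dualObjSvm {m : ℕ} (γ lam Kii : ℝ) (n : ℕ) (y : Fin m)
    (q v : Fin m → ℝ) : ℝ :=
  -(1/(n:ℝ)) * (γ/2 * ∑ j : {j : Fin m // j ≠ y}, ((lam * n) * v j.1)^2 -
      ∑ j : {j : Fin m // j ≠ y}, (-((lam * n) * v j.1))) -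
    (lam/2) * (Kii * ∑ j, (v j)^2 + 2 * ∑ j, q j * v j)

/-- The biased projection objective `‖x − b‖² + ρ⟨1, x⟩²`. -/
noncomputable def projObjSvm {m : ℕ} (γ lam Kii : ℝ) (n : ℕ) (y : Fin m)
    (q : Fin m → ℝ) (x : {j : Fin m // j ≠ y} → ℝ) : ℝ :=
  ∑ j, (x j - (q j.1 + (1 - q y)) / (Kii + γ * lam * n))^2 +
    (Kii / (Kii + γ * lam * n)) * (∑ j, x j)^2

lemma sum_split_y {m : ℕ} (y : Fin m) (f : Fin m → ℝ) :
    ∑ j, f j = f y + ∑ j : {j : Fin m // j ≠ y}, f j.1 := by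
  rw [← Finset.add_sum_erase _ f (Finset.mem_univ y)]
  congr 1
  exact Finset.sum_subtype _ (by simp) f

lemma dual_eq_proj {m : ℕ} (γ lam Kii : ℝ) (n : ℕ) (hn : (0:ℝ) < n)
    (hC : 0 < Kii + γ * lam * n) (y : Fin m) (q v : Fin m → ℝ) (hv : ∑ j, v j = 0) :
    dualObjSvm γ lam Kii n y q v =
      -(lam / 2 * (Kii + γ * lam * n)) * (projObjSvm γ lam Kii n y q (fun j => -v j.1) -
        ∑ j : {j : Fin m // j ≠ y}, ((q j.1 + (1 - q y)) / (Kii + γ * lam * n))^2) := by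
  unfold dualObjSvm projObjSvm
  rw [sum_split_y y] at hv
  rw [sum_split_y y (fun j => (v j)^2), sum_split_y y (fun j => q j * v j)]
  have hy : v y = -∑ j : {j : Fin m // j ≠ y}, v j.1 := by linarith
  have e1 : ∑ j : {j : Fin m // j ≠ y}, ((lam * n) * v j.1)^2
      = (lam * n)^2 * ∑ j : {j : Fin m // j ≠ y}, (v j.1)^2 := by
    rw [Finset.mul_sum]; exact Finset.sum_congr rfl fun _ _ => by ring
  have e2 : ∑ j : {j : Fin m // j ≠ y}, (-((lam * n) * v j.1))
      = -(lam * n) * ∑ j : {j : Fin m // j ≠ y}, v j.1 := by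
    rw [Finset.mul_sum]; exact Finset.sum_congr rfl fun _ _ => by ring
  have e3 : ∑ j : {j : Fin m // j ≠ y},
        (-v j.1 - (q j.1 + (1 - q y)) / (Kii + γ * lam * n))^2
      = ∑ j : {j : Fin m // j ≠ y}, (v j.1)^2
        + 2 / (Kii + γ * lam * n) * (∑ j : {j : Fin m // j ≠ y}, q j.1 * v j.1)
        + 2 * (1 - q y) / (Kii + γ * lam * n) * (∑ j : {j : Fin m // j ≠ y}, v j.1)
        + ∑ j : {j : Fin m // j ≠ y}, ((q j.1 + (1 - q y)) / (Kii + γ * lam * n))^2 := by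
    rw [Finset.mul_sum, Finset.mul_sum, ← Finset.sum_add_distrib, ← Finset.sum_add_distrib,
      ← Finset.sum_add_distrib]
    exact Finset.sum_congr rfl fun _ _ => by ring
  rw [e1, e2, e3, hy, Finset.sum_neg_distrib]
  generalize (∑ j : {j : Fin m // j ≠ y}, ((q j.1 + (1 - q y)) / (Kii + γ * lam * n))^2) = B
  generalize (∑ j : {j : Fin m // j ≠ y}, q j.1 * v j.1) = Q
  generalize (∑ j : {j : Fin m // j ≠ y}, (v j.1)^2) = V
  generalize (∑ j : {j : Fin m // j ≠ y}, v j.1) = S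
  have hC' := hC.ne'
  have hn' := hn.ne'
  obtain ⟨C, hCd⟩ : ∃ C, C = Kii + γ * lam * n := ⟨_, rfl⟩
  have hK : Kii = C - γ * lam * n := by linarith
  rw [← hCd] at hC' ⊢
  rw [hK]
  field_simp
  ring

lemma feas_iff {m : ℕ} (k : ℕ) (y : Fin m) (c : ℝ) (hc : 0 < c)
    (x : {j : Fin m // j ≠ y} → ℝ) :
    inTopkSimplex k y 1 (fun j => c * x j) ↔ inTopkSimplex k y (1 / c) x := by
  unfold inTopkSimplex
  simp only [← Finset.mul_sum]
  refine and_congr ?_ (forall_congr' fun j => and_congr ?_ ?_)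
  · rw [le_div_iff₀ hc, mul_comm]
  · exact mul_nonneg_iff_of_pos_left hc
  · rw [mul_left_comm, mul_le_mul_iff_right₀ hc]

lemma sum_iff {m : ℕ} (c : ℝ) (hc : 0 < c) (v : Fin m → ℝ) :
    ∑ j, (-(c * v j)) = 0 ↔ ∑ j, v j = 0 := by
  rw [Finset.sum_neg_distrib, ← Finset.mul_sum, neg_eq_zero, mul_eq_zero]
  simp [hc.ne']

theorem stmt_15 (m k n : ℕ) (hm : 2 ≤ m) (hk1 : 1 ≤ k) (hkm : k ≤ m - 1)
    (hn : 1 ≤ n) (γ lam Kii : ℝ) (hγ : 0 ≤ γ) (hlam : 0 < lam) (hKii : 0 < Kii)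
    (y : Fin m) (q : Fin m → ℝ) :
    ∀ v : Fin m → ℝ,
      -- `v` maximizes `D_i` (in particular `−λnv` is dual feasible)
      (((∑ j, (-((lam * n) * v j)) = 0) ∧
          inTopkSimplex k y 1 (fun j => -((lam * n) * v j.1))) ∧
        ∀ v' : Fin m → ℝ,
          ((∑ j, (-((lam * n) * v' j)) = 0) ∧
            inTopkSimplex k y 1 (fun j => -((lam * n) * v' j.1))) →
          dualObjSvm γ lam Kii n y q v' ≤ dualObjSvm γ lam Kii n y q v) ↔
      -- iff `⟨1, v⟩ = 0` and `−v^{\y}` is the (unique) minimizer of the biased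
      -- projection problem over `Δ^α_k(1/(λn))`
      ((∑ j, v j = 0) ∧
        inTopkSimplex k y (1/(lam * n)) (fun j => -v j.1) ∧
        ∀ x : {j : Fin m // j ≠ y} → ℝ, inTopkSimplex k y (1/(lam * n)) x →
          projObjSvm γ lam Kii n y q (fun j => -v j.1) ≤
            projObjSvm γ lam Kii n y q x) := by
  have hn0 : (0:ℝ) < n := by exact_mod_cast hn
  have hc : 0 < lam * n := mul_pos hlam hn0
  have hC : 0 < Kii + γ * lam * n := by positivity
  have hL : 0 < lam / 2 * (Kii + γ * lam * n) := by positivity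
  have hf : ∀ v : Fin m → ℝ, inTopkSimplex k y 1 (fun j => -((lam * n) * v j.1)) ↔
      inTopkSimplex k y (1/(lam * n)) (fun j => -v j.1) := by
    intro v
    rw [← feas_iff k y _ hc]
    simp only [mul_neg]
  have key : ∀ v v' : Fin m → ℝ, ∑ j, v j = 0 → ∑ j, v' j = 0 →
      (dualObjSvm γ lam Kii n y q v' ≤ dualObjSvm γ lam Kii n y q v ↔
        projObjSvm γ lam Kii n y q (fun j => -v j.1) ≤
          projObjSvm γ lam Kii n y q (fun j => -v' j.1)) := by
    intro v v' hv hv'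
    rw [dual_eq_proj γ lam Kii n hn0 hC y q v hv, dual_eq_proj γ lam Kii n hn0 hC y q v' hv',
      neg_mul, neg_mul, neg_le_neg_iff, mul_le_mul_iff_right₀ hL, sub_le_sub_iff_right]
  intro v
  simp only [sum_iff _ hc, hf]
  constructor
  · rintro ⟨⟨h1, h2⟩, h3⟩
    refine ⟨h1, h2, fun x hx => ?_⟩
    let v' : Fin m → ℝ := fun j => if h : j ≠ y then -x ⟨j, h⟩ else ∑ l, x l
    have hvx : (fun j : {j : Fin m // j ≠ y} => -v' j.1) = x := by
      funext j
      simp [v', j.2]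
    have hs : ∑ j, v' j = 0 := by
      rw [sum_split_y y, ← neg_eq_zero, neg_add, ← Finset.sum_neg_distrib, hvx]
      simp [v']
    have := (key v v' h1 hs).1 (h3 v' ⟨hs, by rw [hvx]; exact hx⟩)
    rwa [hvx] at this
  · rintro ⟨h1, h2, h3⟩
    exact ⟨⟨h1, h2⟩, fun v' hv' => (key v v' h1 hv'.1).2 (h3 _ hv'.2)⟩
end

section
/- Fix m ≥ 2, a nonempty proper subset Y ⊊ {1,…,m} with complement Ȳ, k = |Y|, λ > 0, n ≥ 1, K_ii > 0, and q ∈ ℝ^m; set α = K_ii/(λn), b = ( q_j/α + 1/k )_{j ∈ Y}, and b̄ = ( q_j/α )_{j ∈ Ȳ}. Let L* be the conjugate of the multilabel cross-entropy loss (finite, with value Σ_{y∈Y}(w_y + 1/k)log(w_y + 1/k) + Σ_{j∈Ȳ} w_j log w_j, exactly on the set D_Y). Then the maximizer v* over v ∈ ℝ^m of D_i(v) = −(1/n)·L*(−λ n v) − (λ/2)( K_ii·⟨v,v⟩ + 2⟨q,v⟩ ) satisfies (v*_y)_{y ∈ Y} = −(1/(λn))·( p − (1/k)·1 ) and (v*_j)_{j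 ∈ Ȳ} = −(1/(λn))·p̄, where (p, p̄) is the unique minimizer of (α/2)‖x − b‖² + ⟨x, log x⟩ + (α/2)‖z − b̄‖² + ⟨z, log z⟩ over x ∈ ℝ^{|Y|}, z ∈ ℝ^{|Ȳ|} with x ≥ 0, z ≥ 0, ⟨1, x⟩ + ⟨1, z⟩ = 1. Moreover, the minimizer has strictly positive components given by p_j = (1/α)·w(α b_j − t) and p̄_j = (1/α)·w(α b̄_j − t), where for τ ∈ ℝ, w(τ) denotes the unique ξ > 0 satisfying ξ + log ξ = τ, and t ∈ ℝ is determined by the equation Σ_{j ∈ Y} w( q_j + α/k − t ) + Σ_{j ∈ Ȳ} w( q_j − t ) = α. -/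
open Finset

/-- Membership of `w` in the set `D_Y` (with `k = |Y|`). -/
def inDY {m : ℕ} (Y : Finset (Fin m)) (w : Fin m → ℝ) : Prop :=
  (∑ y ∈ Y, (w y + 1/(Y.card : ℝ))) + (∑ j ∈ Yᶜ, w j) = 1 ∧
    (∀ y ∈ Y, 0 ≤ w y + 1/(Y.card : ℝ)) ∧ ∀ j ∈ Yᶜ, 0 ≤ w j

/-- The dual SDCA objective for the multilabel cross-entropy loss, evaluated at a
feasible `v`: `D_i(v) = −(1/n)·L*(−λnv) − (λ/2)(K_ii⟨v,v⟩ + 2⟨q,v⟩)`, with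
`L*(w) = ∑_{y∈Y}(w_y + 1/k)log(w_y + 1/k) + ∑_{j∈Ȳ} w_j log w_j` on `D_Y`. -/
noncomputable def dualObjMlCE {m : ℕ} (Y : Finset (Fin m)) (lam Kii : ℝ)
    (n : ℕ) (q v : Fin m → ℝ) : ℝ :=
  -(1/(n:ℝ)) *
      (∑ y ∈ Y, (-((lam * n) * v y) + 1/(Y.card : ℝ)) *
          Real.log (-((lam * n) * v y) + 1/(Y.card : ℝ)) +
        ∑ j ∈ Yᶜ, (-((lam * n) * v j)) * Real.log (-((lam * n) * v j))) -
    (lam/2) * (Kii * ∑ j, (v j)^2 + 2 * ∑ j, q j * v j)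

/-- The proximal objective
`(α/2)‖x − b‖² + ⟨x, log x⟩ + (α/2)‖z − b̄‖² + ⟨z, log z⟩` with
`α = K_ii/(λn)`, `b = (q_j/α + 1/k)_{j∈Y}`, `b̄ = (q_j/α)_{j∈Ȳ}`. -/
noncomputable def proxObjMlCE {m : ℕ} (Y : Finset (Fin m)) (lam Kii : ℝ)
    (n : ℕ) (q x z : Fin m → ℝ) : ℝ :=
  (Kii / (lam * n)) / 2 *
      ∑ j ∈ Y, (x j - (q j / (Kii / (lam * n)) + 1/(Y.card : ℝ)))^2 +
    (∑ j ∈ Y, x j * Real.log (x j)) +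
    (Kii / (lam * n)) / 2 * ∑ j ∈ Yᶜ, (z j - q j / (Kii / (lam * n)))^2 +
    ∑ j ∈ Yᶜ, z j * Real.log (z j)

/-- The feasible set of the proximal problem:
`x ≥ 0`, `z ≥ 0`, `⟨1, x⟩ + ⟨1, z⟩ = 1`. -/
def proxFeas {m : ℕ} (Y : Finset (Fin m)) (x z : Fin m → ℝ) : Prop :=
  (∀ j ∈ Y, 0 ≤ x j) ∧ (∀ j ∈ Yᶜ, 0 ≤ z j) ∧
    (∑ j ∈ Y, x j) + (∑ j ∈ Yᶜ, z j) = 1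

lemma aux_sum_s19 {m : ℕ} (Y : Finset (Fin m)) (f g : Fin m → ℝ) :
    (∑ j ∈ Y, f j) + (∑ j ∈ Yᶜ, g j) = ∑ j, if j ∈ Y then f j else g j := by
  rw [← Finset.sum_add_sum_compl Y (fun j => if j ∈ Y then f j else g j)]
  congr 1
  · exact Finset.sum_congr rfl (fun j hj => by simp [hj])
  · refine Finset.sum_congr rfl (fun j hj => ?_)
    rw [Finset.mem_compl] at hj
    simp [hj]

lemma aux_gibbs_s19 (u s : ℝ) (hu : 0 ≤ u) (hs : 0 < s) :
    s * Real.log s + (Real.log s + 1) * (u - s) ≤ u * Real.log u := by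
  rcases hu.eq_or_lt with h | h
  · subst h; simp; nlinarith
  · have h1 := Real.log_le_sub_one_of_pos (div_pos hs h)
    rw [Real.log_div hs.ne' h.ne'] at h1
    have h2 : u * (Real.log s - Real.log u) ≤ u * (s / u - 1) :=
      mul_le_mul_of_nonneg_left h1 h.le
    have h3 : u * (s / u - 1) = s - u := by field_simp
    nlinarith

/-- Pointwise strongly convex lower bound. -/
lemma aux_point (al c mu u s : ℝ) (hu : 0 ≤ u) (hs : 0 < s)
    (h : al * (s - c) + Real.log s = mu) :
    al / 2 * (s - c)^2 + s * Real.log s + (mu + 1) * (u - s) + al / 2 * (u - s)^2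
      ≤ al / 2 * (u - c)^2 + u * Real.log u := by
  have := aux_gibbs_s19 u s hu hs
  subst h
  nlinarith

lemma aux_core {m : ℕ} (al mu : ℝ) (hal : 0 < al) (c u s : Fin m → ℝ)
    (hu : ∀ j, 0 ≤ u j) (hs : ∀ j, 0 < s j) (hu1 : ∑ j, u j = 1) (hs1 : ∑ j, s j = 1)
    (h : ∀ j, al * (s j - c j) + Real.log (s j) = mu)
    (hle : ∑ j, (al / 2 * (u j - c j)^2 + u j * Real.log (u j))
      ≤ ∑ j, (al / 2 * (s j - c j)^2 + s j * Real.log (s j))) :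
    ∀ j, u j = s j := by
  have h1 := Finset.sum_le_sum (fun j (_ : j ∈ Finset.univ) =>
    aux_point al (c j) mu (u j) (s j) (hu j) (hs j) (h j))
  rw [Finset.sum_add_distrib, Finset.sum_add_distrib, ← Finset.mul_sum, ← Finset.mul_sum,
    Finset.sum_sub_distrib, hu1, hs1] at h1
  have h2 : ∑ j, (u j - s j)^2 ≤ 0 := by
    by_contra hc
    push Not at hc
    have := mul_pos (half_pos hal) hc
    linarith
  have h3 : ∑ j, (u j - s j)^2 = 0 := le_antisymm h2 (Finset.sum_nonneg fun j _ => sq_nonneg _)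
  intro j
  have h4 := (Finset.sum_eq_zero_iff_of_nonneg (fun j _ => sq_nonneg (u j - s j))).1 h3 j
    (Finset.mem_univ j)
  have h5 := pow_eq_zero_iff (two_ne_zero) |>.1 h4
  linarith

lemma aux_Wmono (W : ℝ → ℝ) (hW : ∀ τ, 0 < W τ ∧ W τ + Real.log (W τ) = τ) :
    StrictMono W := by
  intro a b hab
  by_contra hc
  push Not at hc
  have := Real.log_le_log (hW b).1 hc
  linarith [(hW a).2, (hW b).2]

lemma aux_Wcont (W : ℝ → ℝ) (hW : ∀ τ, 0 < W τ ∧ W τ + Real.log (W τ) = τ) :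
    Continuous W := by
  refine (LipschitzWith.of_le_add (f := W) ?_).continuous
  intro a b
  rcases le_total a b with h | h
  · have := (aux_Wmono W hW).monotone h
    linarith [dist_nonneg (x := a) (y := b)]
  · have h1 := (aux_Wmono W hW).monotone h
    have := Real.log_le_log (hW b).1 h1
    rw [Real.dist_eq, abs_of_nonneg (by linarith)]
    linarith [(hW a).2, (hW b).2]

lemma aux_t {m : ℕ} (hm : 2 ≤ m) (W : ℝ → ℝ)
    (hW : ∀ τ, 0 < W τ ∧ W τ + Real.log (W τ) = τ)
    (hWuniq : ∀ τ ξ, 0 < ξ → ξ + Real.log ξ = τ → ξ = W τ)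
    (al : ℝ) (hal : 0 < al) (a : Fin m → ℝ) :
    ∃! t : ℝ, ∑ j, W (a j - t) = al := by
  have hmono := aux_Wmono W hW
  let j0 : Fin m := ⟨0, by omega⟩
  have hanti : StrictAnti (fun t => ∑ j, W (a j - t)) := by
    intro x y hxy
    exact Finset.sum_lt_sum_of_nonempty ⟨j0, Finset.mem_univ _⟩
      (fun j _ => hmono (by linarith))
  have hcont : Continuous (fun t => ∑ j, W (a j - t)) := by
    have := aux_Wcont W hW
    fun_prop
  have hm0 : (0:ℝ) < m := by exact_mod_cast (by omega : 0 < m)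
  have hi : al ≤ ∑ j, W (a j - (a j0 - (al + Real.log al))) := by
    have h1 : W (a j0 - (a j0 - (al + Real.log al))) = al :=
      (hWuniq _ _ hal (by ring)).symm
    calc al = W (a j0 - (a j0 - (al + Real.log al))) := h1.symm
      _ ≤ _ := Finset.single_le_sum (f := fun j => W (a j - (a j0 - (al + Real.log al))))
        (fun j _ => (hW _).1.le) (Finset.mem_univ j0)
  have lo : ∑ j, W (a j - (∑ i, |a i| - (al / m + Real.log (al / m)))) ≤ al := by
    have h1 : W (al / m + Real.log (al / m)) = al / m :=
      (hWuniq _ _ (div_pos hal hm0) rfl).symm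
    calc _ ≤ ∑ j : Fin m, al / m := by
          refine Finset.sum_le_sum fun j _ => ?_
          rw [← h1]
          refine hmono.monotone ?_
          rw [h1]
          have := Finset.single_le_sum (f := fun j => |a j|)
            (fun j _ => abs_nonneg _) (Finset.mem_univ j)
          have h3 := le_abs_self (a j)
          linarith
      _ = al := by simp; field_simp
  obtain ⟨t, ht⟩ := mem_range_of_exists_le_of_exists_ge hcont ⟨_, lo⟩ ⟨_, hi⟩
  exact ⟨t, ht, fun t' ht' => hanti.injective (ht'.trans ht.symm)⟩

/-- The candidate minimizer is feasible and every feasible point doing at least as well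
coincides with it. -/
lemma aux_main {m : ℕ} (n : ℕ) (hn : 1 ≤ n) (Y : Finset (Fin m)) (lam Kii : ℝ)
    (hlam : 0 < lam) (hKii : 0 < Kii) (q : Fin m → ℝ)
    (W : ℝ → ℝ) (hW : ∀ τ, 0 < W τ ∧ W τ + Real.log (W τ) = τ) (t : ℝ)
    (c : Fin m → ℝ) (hc : c = fun j => if j ∈ Y then
      q j / (Kii / (lam * n)) + 1/(Y.card : ℝ) else q j / (Kii / (lam * n)))
    (s : Fin m → ℝ) (hs : s = fun j => (1 / (Kii / (lam * n))) * W ((Kii / (lam * n)) * c j - t))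
    (ht : ∑ j, W ((Kii / (lam * n)) * c j - t) = Kii / (lam * n)) :
    proxFeas Y s s ∧ (∀ j, 0 < s j) ∧ ∀ x z : Fin m → ℝ, proxFeas Y x z →
      proxObjMlCE Y lam Kii n q x z ≤ proxObjMlCE Y lam Kii n q s s →
      (∀ j ∈ Y, x j = s j) ∧ ∀ j ∈ Yᶜ, z j = s j := by
  have hn0 : (0:ℝ) < n := by exact_mod_cast hn
  have hobj : ∀ x z : Fin m → ℝ, proxObjMlCE Y lam Kii n q x z =
      ∑ j, ((Kii / (lam * n)) / 2 * ((if j ∈ Y then x j else z j) - c j)^2 +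
        (if j ∈ Y then x j else z j) * Real.log (if j ∈ Y then x j else z j)) := by
    intro x z
    unfold proxObjMlCE
    rw [Finset.mul_sum, Finset.mul_sum, ← Finset.sum_add_distrib, add_assoc,
      ← Finset.sum_add_distrib, aux_sum_s19]
    refine Finset.sum_congr rfl fun j _ => ?_
    rw [hc]
    by_cases h : j ∈ Y <;> simp [h]
  have hal : 0 < Kii / (lam * n) := by positivity
  generalize Kii / (lam * n) = al at *
  have hspos : ∀ j, 0 < s j := by
    intro j; rw [hs]; exact mul_pos (by positivity) (hW _).1
  have hs1 : ∑ j, s j = 1 := by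
    rw [hs, ← Finset.mul_sum, ht]; field_simp
  have hstat : ∀ j, al * (s j - c j) + Real.log (s j) = - t - Real.log al := by
    intro j
    have h1 : W (al * c j - t) = al * s j := by rw [hs]; field_simp
    have h2 := (hW (al * c j - t)).2
    rw [h1, Real.log_mul hal.ne' (hspos j).ne'] at h2
    linarith
  refine ⟨⟨fun j _ => (hspos j).le, fun j _ => (hspos j).le, ?_⟩, hspos, ?_⟩
  · rw [Finset.sum_add_sum_compl, hs1]
  · intro x z hf hle
    rw [hobj, hobj] at hle
    simp only [ite_self] at hle
    have key := aux_core al _ hal c (fun j => if j ∈ Y then x j else z j) s ?_ hspos ?_ hs1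
      hstat hle
    · constructor
      · intro j hj
        have := key j
        simpa [hj] using this
      · intro j hj
        have := key j
        rw [Finset.mem_compl] at hj
        simpa [hj] using this
    · intro j
      by_cases h : j ∈ Y
      · simpa [h] using hf.1 j h
      · simpa [h] using hf.2.1 j (Finset.mem_compl.2 h)
    · rw [← aux_sum_s19]; exact hf.2.2

lemma aux_dual {m : ℕ} (n : ℕ) (hn : 1 ≤ n) (Y : Finset (Fin m)) (lam Kii : ℝ)
    (hlam : 0 < lam) (hKii : 0 < Kii) (q v : Fin m → ℝ) :
    dualObjMlCE Y lam Kii n q v = -(1/(n:ℝ)) * proxObjMlCE Y lam Kii n q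
      (fun j => -((lam * n) * v j) + 1/(Y.card : ℝ)) (fun j => -((lam * n) * v j))
      + ∑ j, lam / (2 * Kii) * (q j)^2 := by
  have hn0 : (0:ℝ) < n := by exact_mod_cast hn
  unfold dualObjMlCE proxObjMlCE
  have e1 : ∀ j, (-((lam * n) * v j) + 1/(Y.card : ℝ) -
      (q j / (Kii / (lam * n)) + 1/(Y.card : ℝ)))^2 =
      (-((lam * n) * v j) - q j / (Kii / (lam * n)))^2 := fun j => by ring
  simp only [e1]
  have e2 := Finset.sum_add_sum_compl Y
    (fun j => (-((lam * n) * v j) - q j / (Kii / (lam * n)))^2)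
  have e3 : (lam/2) * (Kii * ∑ j, (v j)^2 + 2 * ∑ j, q j * v j) =
      (1/(n:ℝ)) * ((Kii / (lam * n)) / 2 *
        ∑ j, (-((lam * n) * v j) - q j / (Kii / (lam * n)))^2)
      - ∑ j, lam / (2 * Kii) * (q j)^2 := by
    simp only [Finset.mul_sum, ← Finset.sum_add_distrib, ← Finset.sum_sub_distrib]
    refine Finset.sum_congr rfl fun j _ => ?_
    field_simp
    ring
  rw [e3, ← e2]
  ring

theorem stmt_19 (m n : ℕ) (hm : 2 ≤ m) (hn : 1 ≤ n)
    (Y : Finset (Fin m)) (hY1 : Y.Nonempty) (hY2 : Y ≠ Finset.univ)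
    (lam Kii : ℝ) (hlam : 0 < lam) (hKii : 0 < Kii)
    (q : Fin m → ℝ)
    -- `W τ` is the unique `ξ > 0` with `ξ + log ξ = τ` (Lambert W of the exponent)
    (W : ℝ → ℝ) (hW : ∀ τ, 0 < W τ ∧ W τ + Real.log (W τ) = τ)
    (hWuniq : ∀ τ ξ, 0 < ξ → ξ + Real.log ξ = τ → ξ = W τ) :
    ∀ vstar : Fin m → ℝ,
      -- `vstar` maximizes `D_i` (in particular `−λn·vstar ∈ D_Y`)
      (inDY Y (fun j => -((lam * n) * vstar j)) ∧
        ∀ v : Fin m → ℝ, inDY Y (fun j => -((lam * n) * v j)) →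
          dualObjMlCE Y lam Kii n q v ≤ dualObjMlCE Y lam Kii n q vstar) →
      ∀ p pb : Fin m → ℝ,
        -- `(p, pb)` is a minimizer of the proximal problem
        (proxFeas Y p pb ∧
          ∀ x z : Fin m → ℝ, proxFeas Y x z →
            proxObjMlCE Y lam Kii n q p pb ≤ proxObjMlCE Y lam Kii n q x z) →
        -- the maximizer is expressed through the minimizer
        (∀ y ∈ Y, vstar y = -(1/(lam * n)) * (p y - 1/(Y.card : ℝ))) ∧
        (∀ j ∈ Yᶜ, vstar j = -(1/(lam * n)) * pb j) ∧
        -- the minimizer is unique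
        (∀ x z : Fin m → ℝ, proxFeas Y x z →
          (∀ x' z' : Fin m → ℝ, proxFeas Y x' z' →
            proxObjMlCE Y lam Kii n q x z ≤ proxObjMlCE Y lam Kii n q x' z') →
          (∀ j ∈ Y, x j = p j) ∧ ∀ j ∈ Yᶜ, z j = pb j) ∧
        -- `t` is determined by the nonlinear equation, and the minimizer has
        -- strictly positive components given via the Lambert W function
        (∃! t : ℝ,
          (∑ j ∈ Y, W (q j + (Kii / (lam * n))/(Y.card : ℝ) - t)) +
            (∑ j ∈ Yᶜ, W (q j - t)) = Kii / (lam * n)) ∧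
        (∀ t : ℝ,
          (∑ j ∈ Y, W (q j + (Kii / (lam * n))/(Y.card : ℝ) - t)) +
            (∑ j ∈ Yᶜ, W (q j - t)) = Kii / (lam * n) →
          (∀ j ∈ Y, 0 < p j ∧
            p j = (1/(Kii / (lam * n))) *
              W ((Kii / (lam * n)) * (q j / (Kii / (lam * n)) + 1/(Y.card : ℝ)) - t)) ∧
          (∀ j ∈ Yᶜ, 0 < pb j ∧
            pb j = (1/(Kii / (lam * n))) *
              W ((Kii / (lam * n)) * (q j / (Kii / (lam * n))) - t))) := by
  have hn0 : (0:ℝ) < n := by exact_mod_cast hn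
  have hln : 0 < lam * n := by positivity
  have hal : 0 < Kii / (lam * n) := by positivity
  intro vstar hv p pb hp
  obtain ⟨hvf, hvmax⟩ := hv
  obtain ⟨hpf, hpmin⟩ := hp
  obtain ⟨c, hc⟩ : ∃ c : Fin m → ℝ, c = fun j => if j ∈ Y then
      q j / (Kii / (lam * n)) + 1/(Y.card : ℝ) else q j / (Kii / (lam * n)) := ⟨_, rfl⟩
  have hcY : ∀ j ∈ Y, c j = q j / (Kii / (lam * n)) + 1/(Y.card : ℝ) := by
    intro j hj; rw [hc]; simp [hj]
  have hcN : ∀ j ∈ Yᶜ, c j = q j / (Kii / (lam * n)) := by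
    intro j hj; rw [Finset.mem_compl] at hj; rw [hc]; simp [hj]
  have hsum : ∀ t : ℝ, (∑ j ∈ Y, W (q j + (Kii / (lam * n))/(Y.card : ℝ) - t)) +
            (∑ j ∈ Yᶜ, W (q j - t)) = ∑ j, W ((Kii / (lam * n)) * c j - t) := by
    intro t
    rw [← Finset.sum_add_sum_compl Y]
    congr 1
    · refine Finset.sum_congr rfl fun j hj => ?_
      rw [hcY j hj, mul_add, mul_div_cancel₀ _ hal.ne', mul_one_div]
    · refine Finset.sum_congr rfl fun j hj => ?_
      rw [hcN j hj, mul_div_cancel₀ _ hal.ne']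
  have hex := aux_t hm W hW hWuniq _ hal (fun j => (Kii / (lam * n)) * c j)
  simp only [hsum]
  obtain ⟨t, ht, -⟩ := id hex
  have hmain : ∀ t : ℝ, ∑ j, W ((Kii / (lam * n)) * c j - t) = Kii / (lam * n) → _ :=
    fun t ht => aux_main n hn Y lam Kii hlam hKii q W hW t c hc _ rfl ht
  have hopt : ∀ x z : Fin m → ℝ, proxFeas Y x z →
          (∀ x' z' : Fin m → ℝ, proxFeas Y x' z' →
            proxObjMlCE Y lam Kii n q x z ≤ proxObjMlCE Y lam Kii n q x' z') →
          (∀ j ∈ Y, x j = p j) ∧ ∀ j ∈ Yᶜ, z j = pb j := by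
    intro x z hf hmin
    obtain ⟨sf, -, h⟩ := hmain t ht
    obtain ⟨a1, a2⟩ := h x z hf (hmin _ _ sf)
    obtain ⟨b1, b2⟩ := h p pb hpf (hpmin _ _ sf)
    exact ⟨fun j hj => (a1 j hj).trans (b1 j hj).symm,
      fun j hj => (a2 j hj).trans (b2 j hj).symm⟩
  have hvs := hopt (fun j => -((lam * n) * vstar j) + 1/(Y.card : ℝ))
    (fun j => -((lam * n) * vstar j)) ⟨hvf.2.1, hvf.2.2, hvf.1⟩ (by
      intro x z hxz
      obtain ⟨v, hv⟩ : ∃ v : Fin m → ℝ, v = fun j => if j ∈ Y then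
        -(1/(lam * n)) * (x j - 1/(Y.card : ℝ)) else -(1/(lam * n)) * z j := ⟨_, rfl⟩
      have e1 : ∀ j ∈ Y, -((lam * n) * v j) + 1/(Y.card : ℝ) = x j := by
        intro j hj
        rw [hv]; simp only [hj, if_true]
        rw [neg_mul, mul_neg, neg_neg, ← mul_assoc, mul_one_div_cancel hln.ne']; ring
      have e2 : ∀ j ∈ Yᶜ, -((lam * n) * v j) = z j := by
        intro j hj
        rw [Finset.mem_compl] at hj
        rw [hv]; simp only [hj, if_false]
        rw [neg_mul, mul_neg, neg_neg, ← mul_assoc, mul_one_div_cancel hln.ne']; ring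
      have hfeas : inDY Y (fun j => -((lam * n) * v j)) := by
        refine ⟨?_, fun j hj => ?_, fun j hj => ?_⟩
        · rw [Finset.sum_congr rfl e1, Finset.sum_congr rfl e2]; exact hxz.2.2
        · simp only [e1 j hj]; exact hxz.1 j hj
        · simp only [e2 j hj]; exact hxz.2.1 j hj
      have h1 := hvmax v hfeas
      rw [aux_dual n hn Y lam Kii hlam hKii, aux_dual n hn Y lam Kii hlam hKii] at h1
      have h2 : proxObjMlCE Y lam Kii n q (fun j => -((lam * n) * v j) + 1/(Y.card : ℝ))
          (fun j => -((lam * n) * v j)) = proxObjMlCE Y lam Kii n q x z := by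
        unfold proxObjMlCE
        congr 1
        · congr 1
          · congr 1
            · congr 1
              exact Finset.sum_congr rfl fun j hj => by simp only [e1 j hj]
            · exact Finset.sum_congr rfl fun j hj => by simp only [e1 j hj]
          · congr 1
            exact Finset.sum_congr rfl fun j hj => by simp only [e2 j hj]
        · exact Finset.sum_congr rfl fun j hj => by simp only [e2 j hj]
      rw [h2] at h1
      have h3 : (0:ℝ) < 1 / n := by positivity
      exact le_of_mul_le_mul_left (by linarith) h3)
  refine ⟨fun y hy => ?_, fun j hj => ?_, hopt, hex, fun t ht => ?_⟩
  · have h1 : -((lam * n) * vstar y) + 1/(Y.card : ℝ) = p y := hvs.1 y hy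
    have h2 : p y - 1/(Y.card : ℝ) = -((lam * n) * vstar y) := by linarith
    rw [h2, neg_mul_neg, ← mul_assoc, one_div_mul_cancel hln.ne', one_mul]
  · have h1 : -((lam * n) * vstar j) = pb j := hvs.2 j hj
    rw [← h1, neg_mul_neg, ← mul_assoc, one_div_mul_cancel hln.ne', one_mul]
  · obtain ⟨sf, spos, h⟩ := hmain t ht
    obtain ⟨b1, b2⟩ := h p pb hpf (hpmin _ _ sf)
    refine ⟨fun j hj => ?_, fun j hj => ?_⟩
    · rw [← hcY j hj, b1 j hj]; exact ⟨spos j, rfl⟩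
    · rw [← hcN j hj, b2 j hj]; exact ⟨spos j, rfl⟩
end
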